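/- Let a ≥ 3 be an odd integer and let b be a real number with b > a + 3/2. Then for every ε > 0 there is a constant C = C(a,b,ε) such that for all positive integers n, | S_{a,b}(n) − [Γ(a+1)Γ(b+1)/Γ(a+b+2)]·[ζ(a+1)ζ(b+1)/ζ(a+b+2)]·σ_{a+b+1}(n) + (1/2)·ζ(−a)·σ_b(n) | ≤ C·n^{(a+b)/2 + 3/4 + ε}. -/

import Mathlib

open Finset

/-- `σ_a(n) = ∑_{d ∣ n} d^a` for real `a`. -/
noncomputable def sigmaR (a : ℝ) (n : ℕ) : ℝ := ∑ d ∈ n.divisors, (d : ℝ) ^ a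

/-- `S_{a,b}(n) = ∑_{k=1}^{n-1} σ_a(k) σ_b(n-k)`. -/
noncomputable def SR (a b : ℝ) (n : ℕ) : ℝ :=
  ∑ k ∈ Finset.Ico 1 n, sigmaR a k * sigmaR b (n - k)

/-- The Riemann zeta function at a real argument (it takes real values there). -/
noncomputable def zetaR (x : ℝ) : ℝ := (riemannZeta (x : ℂ)).re



open Polynomial in
lemma sq_descent {F : Type*} [Field F] (f : F[X]) (hf : Squarefree f) (hdeg : 1 ≤ f.natDegree) (c : F) (hc : c ≠ 0) :
    ∀ (N : ℕ) (r s : F[X]), s.natDegree ≤ N → r ^ 2 = C c * f * s ^ 2 → r = 0 ∧ s = 0 := by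
  have hf0 : f ≠ 0 := by rintro rfl; simp at hdeg
  have hCc : (C c : F[X]) ≠ 0 := by simpa using hc
  intro N
  induction N using Nat.strong_induction_on with
  | _ N ih =>
    intro r s hs h
    by_cases hs0 : s = 0
    · subst hs0
      refine ⟨?_, rfl⟩
      simpa using h
    have h1 : f ∣ r := by
      apply (hf.dvd_pow_iff_dvd (two_ne_zero)).1
      exact ⟨C c * s ^ 2, by rw [h]; ring⟩
    obtain ⟨t, rfl⟩ := h1
    have h2 : C c * s ^ 2 = f * t ^ 2 := by
      apply mul_left_cancel₀ hf0
      linear_combination -h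
    have h3 : f ∣ s := by
      apply (hf.dvd_pow_iff_dvd (two_ne_zero)).1
      refine ⟨C c⁻¹ * t ^ 2, ?_⟩
      have : C c⁻¹ * C c = (1 : F[X]) := by rw [← C_mul, inv_mul_cancel₀ hc, C_1]
      linear_combination C c⁻¹ * h2 - s ^ 2 * this
    obtain ⟨u, rfl⟩ := h3
    have hu0 : u ≠ 0 := by rintro rfl; simp at hs0
    rw [natDegree_mul hf0 hu0] at hs
    have h4 : t ^ 2 = C c * f * u ^ 2 := by
      apply mul_left_cancel₀ hf0
      linear_combination -h2
    obtain ⟨rfl, rfl⟩ := ih u.natDegree (by omega) t u le_rfl h4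
    simp

open Polynomial in
lemma natDegree_sub_le_aux {F : Type*} [Field F] {f g : F[X]} {n : ℕ} (hf : f.natDegree ≤ n) (hg : g.natDegree ≤ n) :
    (f - g).natDegree ≤ n := (natDegree_sub_le f g).trans (max_le hf hg)

open Polynomial in
lemma stepanov_fac {F : Type*} [Field F] (B M j0 : ℕ) (hj0B : j0 < B) (t : Fin B → F[X])
    (ht : ∀ j : Fin B, (j : ℕ) < j0 → t j = 0) :
    ∃ u : F[X], (∑ j, t j * X ^ ((j : ℕ) * M)) = X ^ (j0 * M) * (t ⟨j0, hj0B⟩ + X ^ M * u) := by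
  classical
  refine ⟨∑ j ∈ univ.filter (fun j : Fin B => j0 < (j : ℕ)), t j * X ^ (((j : ℕ) - j0 - 1) * M), ?_⟩
  rw [mul_add, Finset.mul_sum, Finset.mul_sum]
  rw [← Finset.add_sum_erase univ _ (Finset.mem_univ (⟨j0, hj0B⟩ : Fin B))]
  congr 1
  · ring
  · symm
    apply Finset.sum_subset_zero_on_sdiff
    · intro j hj
      simp only [Finset.mem_filter] at hj
      simp only [Finset.mem_erase, Finset.mem_univ, and_true]
      rintro rfl
      exact lt_irrefl _ hj.2
    · intro j hj
      simp only [Finset.mem_sdiff, Finset.mem_erase, Finset.mem_univ, and_true, Finset.mem_filter, true_and, not_lt] at hj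
      have : (j : ℕ) < j0 := lt_of_le_of_ne hj.2 (fun h => hj.1 (Fin.ext h))
      rw [ht j this, zero_mul]
    · intro j hj
      simp only [Finset.mem_filter, Finset.mem_univ, true_and] at hj
      obtain ⟨i, hi⟩ : ∃ i, (j : ℕ) = j0 + 1 + i := ⟨j - j0 - 1, by omega⟩
      have : (j : ℕ) - j0 - 1 = i := by omega
      rw [this, hi]; ring

set_option maxHeartbeats 1000000 in
open Polynomial in
/-- Stepanov-Bombieri bound for nonresidue values. -/
theorem stepanov {F : Type} [Field F] [Fintype F] [DecidableEq F] (p l : ℕ) [Fact p.Prime] [CharP F p]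
    (M μ D : ℕ) (hM : M = p ^ l) (hMμ : M = 2 * μ + 1) (hq : Fintype.card F = M ^ 2)
    (f : F[X]) (hf : Squarefree f) (hf0 : f.eval 0 ≠ 0) (hdeg : 1 ≤ f.natDegree)
    (hD : f.natDegree ≤ D) (hμ : 2 * D + 1 ≤ μ) :
    (univ.filter (fun y : F => f.eval y ^ ((M ^ 2 - 1) / 2) = -1)).card ≤ (μ + 2 * D) * M := by
  classical
  have hD1 : 1 ≤ D := hdeg.trans hD
  have hfne : f ≠ 0 := by rintro rfl; simp at hdeg
  obtain ⟨A, hA⟩ : ∃ A, A + D = μ := ⟨μ - D, by omega⟩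
  obtain ⟨B, hB⟩ : ∃ B, B = μ + D := ⟨_, rfl⟩
  obtain ⟨A', hA'⟩ : ∃ A', A = A' + 1 := ⟨A - 1, by omega⟩
  obtain ⟨B', hB'⟩ : ∃ B', B = B' + 1 := ⟨B - 1, by omega⟩
  set N := A' * M + D * (μ + 1) + B with hN
  have hMpos : 0 < M := by omega
  let H : (Fin B → F[X]) → (Fin B → F[X]) → F[X] := fun r s =>
    ∑ j, (r j ^ M - f ^ (μ + 1) * s j ^ M) * X ^ (j : ℕ)
  have frob : ∀ x y : F[X], (x - y) ^ M = x ^ M - y ^ M := by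
    intro x y; rw [hM]; exact sub_pow_char_pow x y l
  have frobs : ∀ (g : Fin B → F[X]), (∑ j, g j) ^ M = ∑ j, g j ^ M := by
    intro g; rw [hM]; exact sum_pow_char_pow (p := p) (n := l) univ g
  have Hsub : ∀ r s r' s', H (r - r') (s - s') = H r s - H r' s' := by
    intro r s r' s'
    simp only [H, Pi.sub_apply, frob, ← Finset.sum_sub_distrib]
    exact Finset.sum_congr rfl fun j _ => by ring
  have Hdeg : ∀ r s : Fin B → degreeLT F A, H (fun j => r j) (fun j => s j) ∈ degreeLT F N := by
    intro r s
    apply Submodule.sum_mem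
    intro j _
    have hr := mem_degreeLT.1 (r j).2
    have hs := mem_degreeLT.1 (s j).2
    have key : ∀ t : F[X], t.degree < (A : ℕ) → t.natDegree ≤ A' := by
      intro t ht
      by_cases h0 : t = 0
      · simp [h0]
      have := (natDegree_lt_iff_degree_lt h0).2 ht
      omega
    have hr' := key _ hr
    have hs' := key _ hs
    rw [mem_degreeLT]
    apply lt_of_le_of_lt (b := ((A' * M + D * (μ + 1) + j : ℕ) : WithBot ℕ))
    · rw [← natDegree_le_iff_degree_le]
      apply natDegree_mul_le_of_le _ (natDegree_X_pow_le _)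
      apply natDegree_sub_le_aux
      · refine (natDegree_pow_le).trans ?_
        nlinarith
      · refine (natDegree_mul_le_of_le (natDegree_pow_le) (natDegree_pow_le)).trans ?_
        nlinarith
    · have := j.2
      exact_mod_cast (by omega)
  -- pigeonhole
  let Φ : (Fin B → degreeLT F A) × (Fin B → degreeLT F A) → degreeLT F N := fun rs => ⟨_, Hdeg rs.1 rs.2⟩
  have fin1 : ∀ n, Nonempty (degreeLT F n ≃ (Fin n → F)) := fun n => ⟨(degreeLTEquiv F n).toEquiv⟩
  let ft : ∀ n, Fintype (degreeLT F n) := fun n => Fintype.ofEquiv _ (fin1 n).some.symm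
  have hcard : ∀ n, Fintype.card (degreeLT F n) = Fintype.card F ^ n := by
    intro n
    rw [Fintype.card_congr (fin1 n).some]; simp
  have hlt : Fintype.card (degreeLT F N) < Fintype.card ((Fin B → degreeLT F A) × (Fin B → degreeLT F A)) := by
    rw [Fintype.card_prod, Fintype.card_fun, hcard, hcard, Fintype.card_fin, ← pow_mul, ← pow_add]
    apply Nat.pow_lt_pow_right (Fintype.one_lt_card)
    rw [hN, hB, hMμ]
    subst hA hA'
    nlinarith
  obtain ⟨⟨r1, s1⟩, ⟨r2, s2⟩, hne, heq⟩ := Fintype.exists_ne_map_eq_of_card_lt Φ hlt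
  let r : Fin B → degreeLT F A := r1 - r2
  let s : Fin B → degreeLT F A := s1 - s2
  have hH0 : H (fun j => r j) (fun j => s j) = 0 := by
    have h1 : H (fun j => r1 j) (fun j => s1 j) = H (fun j => r2 j) (fun j => s2 j) := congrArg Subtype.val heq
    have h2 := Hsub (fun j => (r1 j : F[X])) (fun j => s1 j) (fun j => r2 j) (fun j => s2 j)
    rw [h1, sub_self] at h2
    exact h2
  have hrs : ∃ j, (r j : F[X]) ≠ 0 ∨ (s j : F[X]) ≠ 0 := by
    by_contra! hcon
    apply hne
    have : r = 0 := by ext1 j; exact Subtype.ext (hcon j).1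
    have h2 : s = 0 := by ext1 j; exact Subtype.ext (hcon j).2
    rw [Prod.mk.injEq]
    exact ⟨sub_eq_zero.1 this, sub_eq_zero.1 h2⟩
  let R : F[X] := ∑ j, (r j : F[X]) * X ^ ((j : ℕ) * M)
  let S : F[X] := ∑ j, (s j : F[X]) * X ^ ((j : ℕ) * M)
  let G : F[X] := R + f ^ (μ + 1) * S
  have hdeglt : ∀ t : degreeLT F A, (t : F[X]).natDegree ≤ A' := by
    intro t
    by_cases h0 : (t : F[X]) = 0
    · simp [h0]
    have := (natDegree_lt_iff_degree_lt h0).2 (mem_degreeLT.1 t.2)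
    omega
  have hRdeg : ∀ t : Fin B → degreeLT F A, (∑ j, (t j : F[X]) * X ^ ((j : ℕ) * M)).natDegree ≤ A' + B' * M := by
    intro t
    apply natDegree_sum_le_of_forall_le
    intro j _
    apply natDegree_mul_le_of_le (hdeglt _) ((natDegree_X_pow_le _).trans _)
    exact Nat.mul_le_mul_right _ (by have := j.2; omega)
  have hGdeg : G.natDegree ≤ (μ + 2 * D) * M := by
    apply natDegree_add_le_of_degree_le
    · refine (hRdeg r).trans ?_
      nlinarith
    · refine (natDegree_mul_le_of_le natDegree_pow_le (hRdeg s)).trans ?_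
      have h1 : (μ + 1) * f.natDegree ≤ (μ + 1) * D := Nat.mul_le_mul_left _ hD
      have h2 : B' = μ + D - 1 := by omega
      obtain ⟨E, rfl⟩ : ∃ E, D = E + 1 := ⟨D - 1, by omega⟩
      have h3 : B' = μ + E := by omega
      rw [h3]
      have : A' ≤ μ := by omega
      nlinarith
  have hG0 : G ≠ 0 := by
    intro hG
    -- R^2 = f * f^M * S^2
    have e1 : R ^ 2 = f * f ^ M * S ^ 2 := by
      have : R = - (f ^ (μ + 1) * S) := eq_neg_of_add_eq_zero_left hG
      rw [this, hMμ]; ring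
    -- minimal index
    let P : ℕ → Prop := fun j => ∃ h : j < B, (r ⟨j, h⟩ : F[X]) ≠ 0 ∨ (s ⟨j, h⟩ : F[X]) ≠ 0
    have hP : ∃ j, P j := by obtain ⟨j, hj⟩ := hrs; exact ⟨j, j.2, hj⟩
    let j0 := Nat.find hP
    obtain ⟨hj0B, hj0⟩ := Nat.find_spec hP
    have hmin : ∀ j : Fin B, (j : ℕ) < j0 → (r j : F[X]) = 0 ∧ (s j : F[X]) = 0 := by
      intro j hj
      have := Nat.find_min hP hj
      by_contra hcon
      exact this ⟨j.2, by tauto⟩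
    obtain ⟨u, hu⟩ := stepanov_fac B M j0 hj0B (fun j => (r j : F[X])) (fun j hj => (hmin j hj).1)
    obtain ⟨v, hv⟩ := stepanov_fac B M j0 hj0B (fun j => (s j : F[X])) (fun j hj => (hmin j hj).2)
    set r0 : F[X] := ((r ⟨j0, hj0B⟩ : degreeLT F A) : F[X])
    set s0 : F[X] := ((s ⟨j0, hj0B⟩ : degreeLT F A) : F[X])
    change R = _ at hu
    change S = _ at hv
    obtain ⟨g, hg⟩ : ∃ g, f = C (f.eval 0) + X * g := by
      refine ⟨divX f, ?_⟩
      rw [← coeff_zero_eq_eval_zero]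
      nth_rewrite 1 [← X_mul_divX_add f]
      ring
    set c0 := f.eval 0
    have hfM : f ^ M = C (c0 ^ M) + X ^ M * g ^ M := by
      conv_lhs => rw [hg]
      rw [hM, add_pow_char_pow]; simp [mul_pow]
    have e2 : (r0 + X ^ M * u) ^ 2 = f * f ^ M * (s0 + X ^ M * v) ^ 2 := by
      have hX : (X ^ (j0 * M) : F[X]) ^ 2 ≠ 0 := pow_ne_zero _ (pow_ne_zero _ X_ne_zero)
      apply mul_left_cancel₀ hX
      rw [hu, hv] at e1
      linear_combination e1
    have e3 : X ^ M ∣ r0 ^ 2 - C (c0 ^ M) * f * s0 ^ 2 := by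
      rw [hfM] at e2
      refine ⟨f * g ^ M * (s0 + X ^ M * v) ^ 2 + C (c0 ^ M) * f * (2 * s0 * v + X ^ M * v ^ 2) - 2 * r0 * u - X ^ M * u ^ 2, ?_⟩
      linear_combination e2
    have e4 : r0 ^ 2 - C (c0 ^ M) * f * s0 ^ 2 = 0 := by
      by_contra hne0
      have h1 := natDegree_le_of_dvd e3 hne0
      rw [natDegree_X_pow] at h1
      have h2 : (r0 ^ 2 - C (c0 ^ M) * f * s0 ^ 2).natDegree ≤ 2 * A' + D := by
        apply natDegree_sub_le_aux
        · refine natDegree_pow_le.trans ?_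
          have := hdeglt (r ⟨j0, hj0B⟩); change r0.natDegree ≤ _ at this
          omega
        · have := hdeglt (s ⟨j0, hj0B⟩); change s0.natDegree ≤ _ at this
          refine (natDegree_mul_le_of_le ((natDegree_C_mul_le _ _).trans hD) natDegree_pow_le).trans ?_
          omega
      omega
    have e5 := sq_descent f hf hdeg (c0 ^ M) (pow_ne_zero _ hf0) _ r0 s0 le_rfl (sub_eq_zero.1 e4)
    rcases hj0 with h | h
    · exact h e5.1
    · exact h e5.2
  refine le_trans ?_ hGdeg
  refine le_trans ?_ (card_roots' G)
  refine le_trans ?_ (Multiset.toFinset_card_le _)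
  apply Finset.card_le_card
  intro y hy
  simp only [Finset.mem_filter, Finset.mem_univ, true_and] at hy
  rw [Multiset.mem_toFinset, mem_roots hG0, IsRoot]
  have hyq : y ^ (M ^ 2) = y := by rw [← hq]; exact FiniteField.pow_card y
  have : eval y G ^ M = 0 := by
    rw [← eval_pow]
    have hGM : G ^ M = ∑ j, ((r j : F[X]) ^ M + f ^ ((μ + 1) * M) * (s j : F[X]) ^ M) * X ^ ((j : ℕ) * M ^ 2) := by
      have : G = ∑ j, ((r j : F[X]) + f ^ (μ + 1) * (s j : F[X])) * X ^ ((j : ℕ) * M) := by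
        simp only [G, R, S, Finset.mul_sum, ← Finset.sum_add_distrib]
        exact Finset.sum_congr rfl fun j _ => by ring
      rw [this, frobs]
      refine Finset.sum_congr rfl fun j _ => ?_
      rw [mul_pow]
      have : ((r j : F[X]) + f ^ (μ + 1) * (s j : F[X])) ^ M = (r j : F[X]) ^ M + (f ^ (μ + 1) * (s j : F[X])) ^ M := by
        rw [hM]; exact add_pow_char_pow _ _ p l
      rw [this]; ring
    have h3 : eval y (H (fun j => r j) (fun j => s j)) = 0 := by rw [hH0]; simp
    rw [hGM, eval_finsetSum]
    rw [← h3]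
    simp only [H]
    rw [eval_finsetSum]
    refine Finset.sum_congr rfl fun j _ => ?_
    simp only [eval_mul, eval_add, eval_sub, eval_pow, eval_X]
    have e1 : y ^ ((j : ℕ) * M ^ 2) = y ^ (j : ℕ) := by rw [mul_comm, pow_mul, hyq]
    have e2 : eval y f ^ ((μ + 1) * M) = - eval y f ^ (μ + 1) := by
      have : (μ + 1) * M = (M ^ 2 - 1) / 2 + (μ + 1) := by
        have : (M ^ 2 - 1) / 2 = 2 * μ ^ 2 + 2 * μ := by
          have : M ^ 2 - 1 = 2 * (2 * μ ^ 2 + 2 * μ) := by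
            rw [hMμ]; apply Nat.sub_eq_of_eq_add; ring
          omega
        rw [this, hMμ]; ring
      rw [this, pow_add, hy]; ring
    rw [e1, e2]; ring
  exact eq_zero_of_pow_eq_zero this


open Polynomial in
lemma AS_card {F : Type} [Field F] [Fintype F] [DecidableEq F] (p l : ℕ) [Fact p.Prime] [CharP F p]
    (M : ℕ) (hM : M = p ^ l) (hp2 : p ≠ 2) (hq : Fintype.card F = M ^ 2) (hMbig : 16 * p + 3 ≤ M)
    (a b : F) (ha : a ≠ 0) (hb : b ≠ 0) (T : F →+ ZMod p) (hT : ∀ y, T (y ^ p) = T y) :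
    M ^ 2 ≤ p * (univ.filter (fun x : F => x ≠ 0 ∧ T (a * x + b * x⁻¹) = 0)).card + 8 * p * M + 4 * p := by
  classical
  have hp : p.Prime := Fact.out
  have hp1 : 1 < p := hp.one_lt
  have hpodd : Odd p := hp.odd_of_ne_two hp2
  have hMo : Odd M := by rw [hM]; exact hpodd.pow
  obtain ⟨μ, hμ⟩ := hMo
  have h2 : (2 : F) ≠ 0 := by
    have : ((2 : ℕ) : F) ≠ 0 := by
      rw [Ne, CharP.cast_eq_zero_iff F p]
      intro h
      exact hp2 ((Nat.prime_dvd_prime_iff_eq hp Nat.prime_two).1 h)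
    exact_mod_cast this
  have hFchar : ringChar F ≠ 2 := by
    rw [ringChar.eq F p]; exact hp2
  set g : F[X] := X ^ p - X with hg
  set e : F := 4 * a * b with he
  have he0 : e ≠ 0 := by
    have h4 : (4 : F) = 2 * 2 := by norm_num
    rw [he, h4]; exact mul_ne_zero (mul_ne_zero (mul_ne_zero h2 h2) ha) hb
  set f : F[X] := g ^ 2 - C e with hfdef
  have hgdeg : g.natDegree = p := by
    rw [hg]; exact FiniteField.X_pow_card_sub_X_natDegree_eq F hp1
  have hg0 : g ≠ 0 := by rw [hg]; exact FiniteField.X_pow_card_sub_X_ne_zero F hp1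
  have hfdeg : f.natDegree = 2 * p := by
    rw [hfdef, natDegree_sub_C, natDegree_pow, hgdeg]
  have hf0 : f ≠ 0 := by rintro h; rw [h] at hfdeg; simp at hfdeg; omega
  have hder : derivative f = -2 * g := by
    have : derivative g = -1 := by
      rw [hg, derivative_sub, derivative_X_pow, derivative_X]; simp
    rw [hfdef, derivative_sub, derivative_C, pow_two, derivative_mul, this]
    ring
  have hsq : Squarefree f := by
    apply Separable.squarefree
    rw [separable_def, hder]
    refine ⟨- C e⁻¹, - C e⁻¹ * C 2⁻¹ * g, ?_⟩
    have h1 : C e⁻¹ * C e = (1 : F[X]) := by rw [← C_mul, inv_mul_cancel₀ he0, C_1]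
    have h3 : C 2⁻¹ * 2 = (1 : F[X]) := by
      have : (2 : F[X]) = C 2 := rfl
      rw [this, ← C_mul, inv_mul_cancel₀ h2, C_1]
    rw [hfdef]
    linear_combination h1 + C e⁻¹ * g ^ 2 * h3
  have hev : ∀ y, f.eval y = (y ^ p - y) ^ 2 - e := by intro y; simp [hfdef, hg]
  have hev0 : f.eval 0 ≠ 0 := by
    rw [hev]; simp [hp.ne_zero, he0]
  have hst := stepanov p l M μ (2 * p) hM hμ hq f hsq hev0 (by omega) hfdeg.le (by omega)
  set bad := univ.filter (fun y : F => f.eval y ^ ((M ^ 2 - 1) / 2) = -1)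
  set good := univ.filter (fun y : F => f.eval y ≠ 0 ∧ IsSquare (f.eval y))
  set zer := univ.filter (fun y : F => f.eval y = 0)
  have hzer : zer.card ≤ 2 * p := by
    rw [← hfdeg]
    refine le_trans ?_ (card_roots' f)
    refine le_trans ?_ (Multiset.toFinset_card_le _)
    apply Finset.card_le_card
    intro y hy
    simp only [zer, Finset.mem_filter, Finset.mem_univ, true_and] at hy
    rw [Multiset.mem_toFinset, mem_roots hf0]; exact hy
  have hq2 : Fintype.card F / 2 = (M ^ 2 - 1) / 2 := by
    rw [hq, hμ]
    have : (2 * μ + 1) ^ 2 = 2 * (2 * μ ^ 2 + 2 * μ) + 1 := by ring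
    omega
  have htot : M ^ 2 ≤ good.card + bad.card + zer.card := by
    rw [← hq, ← Finset.card_univ]
    refine le_trans (Finset.card_le_card (t := good ∪ bad ∪ zer) ?_) ?_
    · intro y _
      simp only [Finset.mem_union, good, bad, zer, Finset.mem_filter, Finset.mem_univ, true_and]
      by_cases h0 : f.eval y = 0
      · right; exact h0
      · left
        rcases FiniteField.pow_dichotomy hFchar h0 with h | h
        · left; exact ⟨h0, (FiniteField.isSquare_iff hFchar h0).2 h⟩
        · right; rw [← hq2]; exact h
    · exact (Finset.card_union_le _ _).trans (Nat.add_le_add_right (Finset.card_union_le _ _) _)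
  set P := (univ : Finset (F × F)).filter (fun z => z.1 ≠ 0 ∧ z.2 ^ p - z.2 = a * z.1 + b * z.1⁻¹ ∧ z.2 ∈ good)
  set Z := (univ.filter (fun x : F => x ≠ 0 ∧ T (a * x + b * x⁻¹) = 0))
  have hP1 : P.card ≤ p * Z.card := by
    apply Finset.card_le_mul_card_image_of_maps_to (f := Prod.fst)
    · rintro ⟨x, y⟩ hz
      simp only [P, Finset.mem_filter, Finset.mem_univ, true_and] at hz
      simp only [Z, Finset.mem_filter, Finset.mem_univ, true_and]
      refine ⟨hz.1, ?_⟩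
      rw [← hz.2.1, map_sub, hT, sub_self]
    · intro x hx
      have hdeg : (g - C (a * x + b * x⁻¹)).natDegree = p := by rw [natDegree_sub_C, hgdeg]
      have hne : g - C (a * x + b * x⁻¹) ≠ 0 := by
        rintro h; rw [h] at hdeg; simp at hdeg; omega
      calc _ ≤ ((g - C (a * x + b * x⁻¹)).roots.toFinset).card := by
            apply Finset.card_le_card_of_injOn Prod.snd
            · rintro ⟨x', y⟩ hz
              simp only [P, Finset.coe_filter, Finset.mem_filter, Finset.mem_univ, true_and, Set.mem_ofPred_eq] at hz
              rw [Finset.mem_coe, Multiset.mem_toFinset, mem_roots hne, IsRoot]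
              obtain ⟨hz, rfl⟩ := hz
              simp [hg, hz.2.1]
            · rintro ⟨x1, y1⟩ h1 ⟨x2, y2⟩ h2 h
              simp only [Finset.coe_filter, Set.mem_ofPred_eq] at h1 h2 h
              rw [h, h1.2, h2.2]
        _ ≤ _ := Multiset.toFinset_card_le _
        _ ≤ _ := card_roots' _
        _ = p := hdeg
  have hP2 : 2 * good.card ≤ P.card := by
    apply Finset.mul_card_image_le_card_of_maps_to (f := Prod.snd)
    · rintro ⟨x, y⟩ hz
      simp only [P, Finset.mem_filter, Finset.mem_univ, true_and] at hz
      exact hz.2.2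
    · intro y hy
      have hy' := hy
      simp only [good, Finset.mem_filter, Finset.mem_univ, true_and] at hy'
      obtain ⟨hne, w, hw⟩ := hy'
      rw [hev] at hw hne
      have hw0 : w ≠ 0 := by rintro rfl; simp at hw; exact hne hw
      have h2a : 2 * a ≠ 0 := mul_ne_zero h2 ha
      have root : ∀ u : F, u ^ 2 = (y ^ p - y) ^ 2 - e → ((y ^ p - y + u) / (2 * a), y) ∈ P.filter (fun z => z.2 = y) := by
        intro u hu
        simp only [P, Finset.mem_filter, Finset.mem_univ, true_and, and_true]
        have hprod : (y ^ p - y + u) * (y ^ p - y - u) = 4 * a * b := by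
          rw [← he]; linear_combination -hu
        have hne1 : (y ^ p - y + u) ≠ 0 := by
          intro h; rw [h, zero_mul, ← he] at hprod; exact he0 hprod.symm
        refine ⟨div_ne_zero hne1 h2a, ?_, hy⟩
        rw [inv_div]
        field_simp
        linear_combination  hprod
      rw [Nat.succ_le_iff, Finset.one_lt_card]
      refine ⟨_, root w (by rw [hw]; ring), _, root (-w) (by rw [hw]; ring), ?_⟩
      intro h
      rw [Prod.mk.injEq, div_left_inj' h2a] at h
      have : 2 * w = 0 := by linear_combination h.1
      exact hw0 ((mul_eq_zero.1 this).resolve_left h2)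
  -- final arithmetic
  have h5 : 2 * μ * M + M = M ^ 2 := by rw [hμ]; ring
  nlinarith


/-- Kloosterman sum over a finite field. -/
noncomputable def KSf {F : Type} [Field F] [Fintype F] [DecidableEq F] (ψ : AddChar F ℂ) (a b : F) : ℂ :=
  ∑ x : F, if x = 0 then 0 else ψ (a * x + b * x⁻¹)

lemma sum_sq_nonsq {F : Type} [Field F] [Fintype F] [DecidableEq F] (hF : ringChar F ≠ 2) (δ : F)
    (hδ : ¬ IsSquare δ) (h : F → ℂ) :
    ∑ v, h (δ * v ^ 2) + ∑ v, h (v ^ 2) = 2 * ∑ d, h d := by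
  classical
  have hδ0 : δ ≠ 0 := by rintro rfl; exact hδ (IsSquare.zero)
  have key : ∀ g : F → ℂ, ∑ v, g (v ^ 2) = ∑ d, ((quadraticChar F d : ℤ) + 1 : ℂ) * g d := by
    intro g
    rw [← Finset.sum_fiberwise (s := univ) (g := fun v : F => v ^ 2)]
    refine Finset.sum_congr rfl fun d _ => ?_
    rw [Finset.sum_congr rfl (g := fun _ => g d)]
    · rw [Finset.sum_const, nsmul_eq_mul]
      congr 1
      have := quadraticChar_card_sqrts hF d
      have h2 : (((({x : F | x ^ 2 = d}.toFinset).card : ℤ)) : ℂ) = ((quadraticChar F d + 1 : ℤ) : ℂ) := by rw [this]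
      rw [Set.toFinset_ofPred] at h2
      push_cast at h2
      exact h2
    · intro v hv
      simp only [Finset.mem_filter] at hv
      rw [hv.2]
  rw [key h, key (fun d => h (δ * d))]
  have e : ∑ d, ((quadraticChar F d : ℤ) + 1 : ℂ) * h (δ * d) = ∑ d, (-(quadraticChar F d : ℤ) + 1 : ℂ) * h d := by
    refine Fintype.sum_equiv (Equiv.mulLeft₀ δ hδ0) _ _ fun d => ?_
    have : quadraticChar F (δ * d) = - quadraticChar F d := by
      rw [map_mul, quadraticChar_neg_one_iff_not_isSquare.2 hδ]; ring
    simp [Equiv.mulLeft₀, this]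
  rw [e, ← Finset.sum_add_distrib, Finset.mul_sum]
  exact Finset.sum_congr rfl fun d _ => by ring

lemma KSf_quad {F : Type} [Field F] [Fintype F] [DecidableEq F] (hF : ringChar F ≠ 2) (δ : F)
    (hδ : ¬ IsSquare δ) (ψ : AddChar F ℂ) (hψ : ψ ≠ 1) (a b : F) (ha : a ≠ 0) (hb : b ≠ 0) :
    ∑ u : F, ∑ v : F, (if u ^ 2 - δ * v ^ 2 = 0 then 0 else
      ψ (a * (2 * u) + b * ((2 * u) * (u ^ 2 - δ * v ^ 2)⁻¹))) = 2 * Fintype.card F - KSf ψ a b ^ 2 := by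
  classical
  have h2 : (2 : F) ≠ 0 := Ring.two_ne_zero hF
  let g : F → F → ℂ := fun t n => if n = 0 then 0 else ψ (a * t + b * (t * n⁻¹))
  have e1 : KSf ψ a b ^ 2 = ∑ x, ∑ y, g (x + y) (x * y) := by
    rw [pow_two, KSf, Finset.sum_mul_sum]
    refine Finset.sum_congr rfl fun x _ => Finset.sum_congr rfl fun y _ => ?_
    by_cases hx : x = 0
    · simp [g, hx]
    by_cases hy : y = 0
    · simp [g, hy]
    simp only [g, hx, hy, if_false, mul_eq_zero, or_self]
    rw [← AddChar.map_add_eq_mul]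
    congr 1
    field_simp; ring
  have e2 : ∑ x, ∑ y, g (x + y) (x * y) = ∑ u, ∑ w, g (2 * u) (u ^ 2 - w ^ 2) := by
    rw [← Fintype.sum_prod_type', ← Fintype.sum_prod_type']
    symm
    refine Fintype.sum_bijective (fun z : F × F => (z.1 + z.2, z.1 - z.2)) ?_ _ _ ?_
    · apply (Finite.injective_iff_bijective).1
      rintro ⟨x, y⟩ ⟨x', y'⟩ h
      simp only [Prod.mk.injEq] at h ⊢
      obtain ⟨h3, h4⟩ := h
      constructor
      · apply mul_left_cancel₀ h2; linear_combination h3 + h4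
      · apply mul_left_cancel₀ h2; linear_combination h3 - h4
    · rintro ⟨u, w⟩
      simp only
      congr 1 <;> ring
  have e3 : ∑ u : F, ∑ v : F, g (2 * u) (u ^ 2 - δ * v ^ 2) + ∑ u, ∑ w, g (2 * u) (u ^ 2 - w ^ 2)
      = 2 * ∑ t, ∑ n, g t n := by
    rw [← Finset.sum_add_distrib]
    have : ∀ u : F, (∑ v, g (2 * u) (u ^ 2 - δ * v ^ 2)) + ∑ w, g (2 * u) (u ^ 2 - w ^ 2) = 2 * ∑ n, g (2 * u) n := by
      intro u
      rw [sum_sq_nonsq hF δ hδ (fun d => g (2 * u) (u ^ 2 - d))]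
      congr 1
      exact Fintype.sum_equiv (Equiv.subLeft (u ^ 2)) _ _ fun d => rfl
    rw [Finset.sum_congr rfl fun u _ => this u, ← Finset.mul_sum]
    congr 1
    exact Fintype.sum_equiv (Equiv.mulLeft₀ (2 : F) h2) _ _ fun d => rfl
  have e4 : ∑ t, ∑ n, g t n = Fintype.card F := by
    rw [Finset.sum_comm]
    have hprim : ψ.IsPrimitive := AddChar.IsPrimitive.of_ne_one hψ
    have : ∀ n, ∑ t, g t n = if n = - b / a then (Fintype.card F : ℂ) else 0 := by
      intro n
      by_cases hn : n = 0
      · have : (0 : F) ≠ -b / a := (div_ne_zero (neg_ne_zero.2 hb) ha).symm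
        simp [g, hn, this]
      · have : ∀ t, g t n = ψ (t * (a + b * n⁻¹)) := by
          intro t; simp only [g, hn, if_false]; congr 1; ring
        simp only [this]
        rw [AddChar.sum_mulShift _ hprim]
        have : a + b * n⁻¹ = 0 ↔ n = - b / a := by
          field_simp
          constructor <;> intro h
          · linear_combination h
          · linear_combination h
        simp [this]
    rw [Finset.sum_congr rfl fun n _ => this n]
    simp
  have e5 : ∑ u : F, ∑ v : F, (if u ^ 2 - δ * v ^ 2 = 0 then 0 else
      ψ (a * (2 * u) + b * ((2 * u) * (u ^ 2 - δ * v ^ 2)⁻¹))) = ∑ u : F, ∑ v : F, g (2 * u) (u ^ 2 - δ * v ^ 2) := rfl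
  rw [e5, e1, e2, ← e4]
  linear_combination e3

noncomputable def psiT {F : Type} [Field F] {p : ℕ} (ψ : AddChar (ZMod p) ℂ) (T : F →+ ZMod p) (c : ZMod p) : AddChar F ℂ :=
  (ψ.mulShift c).compAddMonoidHom T

lemma psiT_apply {F : Type} [Field F] {p : ℕ} (ψ : AddChar (ZMod p) ℂ) (T : F →+ ZMod p) (c : ZMod p) (x : F) :
  psiT ψ T c x = ψ (c * T x) := rfl

noncomputable def yseq (p : ℕ) (y0 : ℝ) : ℕ → ℝ
  | 0 => y0
  | (j + 1) => 2 * (p : ℝ) ^ (2 ^ j) - (yseq p y0 j) ^ 2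

lemma tower (p : ℕ) [Fact p.Prime] (hp2 : p ≠ 2) (ψ : AddChar (ZMod p) ℂ) (hψ : ψ ≠ 1) (a b : ZMod p) (ha : a ≠ 0)
    (hb : b ≠ 0) (y0 : ZMod p → ℝ) (hy0 : ∀ c, c ≠ 0 → KSf (ψ.mulShift c) a b = y0 c) (j : ℕ) :
    ∃ (F : Type) (_ : Field F) (_ : Fintype F) (_ : DecidableEq F) (_ : CharP F p) (T : F →+ ZMod p) (a' b' : F),
      Fintype.card F = p ^ (2 ^ j) ∧ (∀ y, T (y ^ p) = T y) ∧ Function.Surjective T ∧ a' ≠ 0 ∧ b' ≠ 0 ∧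
      ∀ c, c ≠ 0 → KSf (psiT ψ T c) a' b' = yseq p (y0 c) j := by
  classical
  have hp : p.Prime := Fact.out
  have hpodd : Odd p := hp.odd_of_ne_two hp2
  induction j with
  | zero =>
    refine ⟨ZMod p, inferInstance, inferInstance, inferInstance, inferInstance, AddMonoidHom.id _, a, b, ?_, ?_, ?_, ha, hb, ?_⟩
    · simp [ZMod.card]
    · intro y; simp
    · exact Function.surjective_id
    · intro c hc; rw [yseq, ← hy0 c hc]; rfl
  | succ j ih =>
    obtain ⟨F, iF, iFt, iD, iC, T, a', b', hcard, hT, hTs, ha', hb', hK⟩ := ih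
    have hF : ringChar F ≠ 2 := by rw [ringChar.eq F p]; exact hp2
    have h2 : (2 : F) ≠ 0 := Ring.two_ne_zero hF
    obtain ⟨δ, hδ⟩ := FiniteField.exists_nonsquare hF
    have : Fact (∀ r : F, r ^ 2 ≠ δ + 0 * r) := ⟨by
      intro r h; exact hδ ⟨r, by rw [← pow_two, h]; ring⟩⟩
    let _ : Fintype (QuadraticAlgebra F δ 0) := Fintype.ofEquiv (F × F) (QuadraticAlgebra.equivProd δ 0).symm
    have : CharP (QuadraticAlgebra F δ 0) p := charP_of_injective_algebraMap (algebraMap F (QuadraticAlgebra F δ 0)).injective p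
    let tr : (QuadraticAlgebra F δ 0) →+ F := { toFun := fun z => 2 * z.re, map_zero' := by simp, map_add' := by intro x y; rw [QuadraticAlgebra.re_add]; ring }
    have htr : ∀ z : (QuadraticAlgebra F δ 0), tr z = 2 * z.re := fun _ => rfl
    have htrp : ∀ z : (QuadraticAlgebra F δ 0), tr (z ^ p) = (tr z) ^ p := by
      intro z
      have h1 : ∀ w, algebraMap F (QuadraticAlgebra F δ 0) (tr w) = w + star w := by
        intro w
        rw [htr]
        ext
        · simp; ring
        · simp
      apply (algebraMap F (QuadraticAlgebra F δ 0)).injective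
      rw [h1, map_pow, h1, add_pow_char, star_pow]
    refine ⟨(QuadraticAlgebra F δ 0), inferInstance, inferInstance, inferInstance, inferInstance, T.comp tr, algebraMap F (QuadraticAlgebra F δ 0) a', algebraMap F (QuadraticAlgebra F δ 0) b', ?_, ?_, ?_, ?_, ?_, ?_⟩
    · rw [Fintype.card_congr (QuadraticAlgebra.equivProd δ 0), Fintype.card_prod, hcard]; ring
    · intro y; simp only [AddMonoidHom.comp_apply, htrp, hT]
    · intro t
      obtain ⟨x, hx⟩ := hTs t
      refine ⟨⟨x / 2, 0⟩, ?_⟩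
      simp only [AddMonoidHom.comp_apply, htr]
      rw [mul_div_cancel₀ _ h2, hx]
    · simpa using ha'
    · simpa using hb'
    · intro c hc
      have hψ' : psiT ψ T c ≠ 1 := by
        intro h
        apply hψ
        ext x
        obtain ⟨z, hz⟩ := hTs (c⁻¹ * x)
        have := DFunLike.congr_fun h z
        rw [psiT_apply, hz, mul_inv_cancel_left₀ hc] at this
        rw [this]; simp
      have := KSf_quad hF δ hδ (psiT ψ T c) hψ' a' b' ha' hb'
      rw [hK c hc, hcard] at this
      rw [yseq]
      push_cast at this ⊢
      rw [← this, KSf, ← Fintype.sum_prod_type']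
      refine Fintype.sum_equiv (QuadraticAlgebra.equivProd δ 0) _ _ ?_
      intro z
      have hn : z.re ^ 2 - δ * z.im ^ 2 = QuadraticAlgebra.norm z := by
        rw [QuadraticAlgebra.norm_def]; ring
      have h0 : (z = 0) ↔ ((QuadraticAlgebra.equivProd δ 0 z).1 ^ 2 - δ * (QuadraticAlgebra.equivProd δ 0 z).2 ^ 2 = 0) := by
        change _ ↔ z.re ^ 2 - δ * z.im ^ 2 = 0
        rw [hn, QuadraticAlgebra.norm_eq_zero_iff_eq_zero]
      by_cases hz : z = 0
      · rw [if_pos hz, if_pos (h0.1 hz)]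
      · rw [if_neg hz, if_neg (fun h => hz (h0.2 h))]
        rw [psiT_apply, psiT_apply]
        simp only [AddMonoidHom.comp_apply]
        congr 3
        rw [htr]
        change _ = a' * (2 * z.re) + b' * ((2 * z.re) * (z.re ^ 2 - δ * z.im ^ 2)⁻¹)
        rw [hn]
        simp [QuadraticAlgebra.inv_def]
        ring

lemma KSf_real (p : ℕ) [Fact p.Prime] (ψ : AddChar (ZMod p) ℂ) (a b : ZMod p) : ∃ y : ℝ, KSf ψ a b = y := by
  have : (starRingEnd ℂ) (KSf ψ a b) = KSf ψ a b := by
    rw [KSf, map_sum]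
    refine Fintype.sum_equiv (Equiv.neg _) _ _ fun x => ?_
    by_cases hx : x = 0
    · simp [hx]
    · simp only [hx, if_false, Equiv.neg_apply, neg_eq_zero, ← AddChar.map_neg_eq_conj]
      congr 1
      rw [inv_neg]; ring
  exact ⟨_, (Complex.conj_eq_iff_re.1 this).symm⟩

lemma KSf_bound (p : ℕ) [Fact p.Prime] (hp2 : p ≠ 2) (ψ : AddChar (ZMod p) ℂ) (hψ : ψ ≠ 1) (a b : ZMod p) (ha : a ≠ 0)
    (hb : b ≠ 0) : ‖KSf ψ a b‖ ≤ 2 * Real.sqrt p := by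
  classical
  have hp : p.Prime := Fact.out
  have hprim : ψ.IsPrimitive := AddChar.IsPrimitive.of_ne_one hψ
  choose y0 hy0 using fun c => KSf_real p (ψ.mulShift c) a b
  have hp0 : (0 : ℝ) < p := by exact_mod_cast hp.pos
  -- main inequality
  have main : ∀ j, 16 * p + 3 ≤ p ^ (2 ^ j) → ∀ c0, c0 ≠ 0 → (yseq p (y0 c0) j) ^ 2 ≤ 16 * p * (p : ℝ) ^ (2 ^ j) := by
    intro j hj c0 hc0
    obtain ⟨F, iF, iFt, iD, iC, T, a', b', hcard, hT, hTs, ha', hb', hK⟩ := tower p hp2 ψ hψ a b ha hb y0 (fun c _ => hy0 c) (j + 1)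
    set M := p ^ (2 ^ j) with hM
    have hq : Fintype.card F = M ^ 2 := by rw [hcard, hM]; ring
    have h1 := AS_card p (2 ^ j) M hM hp2 hq hj a' b' ha' hb' T hT
    set Z := (univ.filter (fun x : F => x ≠ 0 ∧ T (a' * x + b' * x⁻¹) = 0))
    have h2 : ∑ c : ZMod p, KSf (psiT ψ T c) a' b' = p * Z.card := by
      simp only [KSf]
      rw [Finset.sum_comm]
      have : ∀ x : F, ∑ c : ZMod p, (if x = 0 then 0 else psiT ψ T c (a' * x + b' * x⁻¹))
          = if (x ≠ 0 ∧ T (a' * x + b' * x⁻¹) = 0) then (p : ℂ) else 0 := by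
        intro x
        by_cases hx : x = 0
        · simp [hx]
        · simp only [hx, if_false, psiT_apply]
          rw [AddChar.sum_mulShift _ hprim]
          simp only [ZMod.card, ne_eq, hx, not_false_eq_true, true_and]
          split_ifs <;> simp
      rw [Finset.sum_congr rfl fun x _ => this x, ← Finset.sum_filter, Finset.sum_const, nsmul_eq_mul]
      ring
    have h3 : KSf (psiT ψ T 0) a' b' = (M : ℂ) ^ 2 - 1 := by
      have : ∀ x : F, (if x = 0 then 0 else psiT ψ T 0 (a' * x + b' * x⁻¹)) = (1 : ℂ) - if x = 0 then 1 else 0 := by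
        intro x
        by_cases hx : x = 0
        · simp [hx]
        · simp [hx, psiT_apply]
      rw [KSf, Finset.sum_congr rfl fun x _ => this x, Finset.sum_sub_distrib]
      simp [hq]
    rw [← Finset.add_sum_erase univ _ (Finset.mem_univ (0 : ZMod p)), h3] at h2
    have h4 : ∑ c ∈ univ.erase (0 : ZMod p), KSf (psiT ψ T c) a' b' =
        ((∑ c ∈ univ.erase (0 : ZMod p), (2 * (M : ℝ) - (yseq p (y0 c) j) ^ 2) : ℝ) : ℂ) := by
      rw [Complex.ofReal_sum]
      refine Finset.sum_congr rfl fun c hc => ?_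
      rw [hK c (Finset.ne_of_mem_erase hc), yseq, hM]
      push_cast; rfl
    rw [h4] at h2
    have h5 : (M : ℝ) ^ 2 - 1 + ∑ c ∈ univ.erase (0 : ZMod p), (2 * (M : ℝ) - (yseq p (y0 c) j) ^ 2) = p * Z.card := by
      exact_mod_cast h2
    have h6 : (M : ℝ) ^ 2 ≤ p * Z.card + 8 * p * M + 4 * p := by exact_mod_cast h1
    have hc0' : c0 ∈ univ.erase (0 : ZMod p) := by simp [hc0]
    rw [Finset.sum_sub_distrib, Finset.sum_const, nsmul_eq_mul] at h5
    have h7 : (yseq p (y0 c0) j) ^ 2 ≤ ∑ c ∈ univ.erase (0 : ZMod p), (yseq p (y0 c) j) ^ 2 :=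
      Finset.single_le_sum (f := fun c => (yseq p (y0 c) j) ^ 2) (fun c _ => sq_nonneg _) hc0'
    have h8 : ((univ.erase (0 : ZMod p)).card : ℝ) ≤ p := by
      have : (univ.erase (0 : ZMod p)).card ≤ p := by
        refine (Finset.card_erase_le).trans ?_
        simp [ZMod.card]
      exact_mod_cast this
    have hM1 : (1 : ℝ) ≤ M := by
      have : 1 ≤ M := Nat.one_le_pow _ _ hp.pos
      exact_mod_cast this
    have e : ((p : ℝ) ^ (2 ^ j)) = M := by rw [hM]; push_cast; rfl
    rw [e]
    nlinarith [mul_le_mul_of_nonneg_right h8 (by linarith : (0:ℝ) ≤ 2 * M), mul_le_mul_of_nonneg_left hM1 hp0.le]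
  -- conclude
  have h1 : KSf ψ a b = y0 1 := by rw [← hy0 1, AddChar.mulShift_one]
  rw [h1, Complex.norm_real, Real.norm_eq_abs]
  by_contra! hcon
  have hs : 4 * p < (y0 1) ^ 2 := by
    have h3 := Real.sq_sqrt hp0.le
    have h4 := Real.sqrt_nonneg p
    rw [← sq_abs (y0 1)]
    nlinarith
  set w : ℝ := (y0 1) ^ 2 / p - 4 with hw
  have hw0 : 0 < w := by
    rw [hw, sub_pos, lt_div_iff₀ hp0]; exact hs
  have grow : ∀ j, 4 ^ j * w ≤ (yseq p (y0 1) j) ^ 2 / (p : ℝ) ^ (2 ^ j) - 4 := by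
    intro j
    induction j with
    | zero => simp [yseq, hw]
    | succ j ih =>
      have hP : (0 : ℝ) < (p : ℝ) ^ (2 ^ j) := by positivity
      set Pj := (p : ℝ) ^ (2 ^ j)
      have e : (p : ℝ) ^ (2 ^ (j + 1)) = Pj ^ 2 := by simp only [Pj]; ring
      rw [e, yseq]
      set z := (yseq p (y0 1) j) ^ 2 / Pj with hz
      have e2 : (2 * Pj - yseq p (y0 1) j ^ 2) ^ 2 / Pj ^ 2 = (2 - z) ^ 2 := by
        rw [hz]; field_simp
      rw [e2, pow_succ]
      have : 0 ≤ (4 : ℝ) ^ j * w := by positivity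
      nlinarith
  obtain ⟨j1, hj1⟩ := pow_unbounded_of_one_lt (16 * p / w) (by norm_num : (1 : ℝ) < 4)
  set j := max j1 (16 * p + 3) with hj
  have hbig : 16 * p + 3 ≤ p ^ (2 ^ j) := by
    have h1 : 16 * p + 3 ≤ j := le_max_right _ _
    have h2 : j < 2 ^ j := Nat.lt_two_pow_self
    have h3 : 2 ^ j < p ^ (2 ^ j) := Nat.lt_pow_self hp.one_lt
    omega
  have h2 := main j hbig 1 one_ne_zero
  have h3 := grow j
  have hP : (0 : ℝ) < (p : ℝ) ^ (2 ^ j) := by positivity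
  have h4 : (yseq p (y0 1) j) ^ 2 / (p : ℝ) ^ (2 ^ j) ≤ 16 * p := by
    rw [div_le_iff₀ hP]; exact h2
  have h5 : (4 : ℝ) ^ j1 ≤ 4 ^ j := pow_le_pow_right₀ (by norm_num) (le_max_left _ _)
  rw [div_lt_iff₀ hw0] at hj1
  have := mul_le_mul_of_nonneg_right h5 hw0.le
  linarith


/-- Kloosterman sum for a general modulus and additive character. -/
noncomputable def KS {q : ℕ} [NeZero q] (ψ : AddChar (ZMod q) ℂ) (n m : ZMod q) : ℂ :=
  ∑ x : (ZMod q)ˣ, ψ (n * x + m * (x⁻¹ : (ZMod q)ˣ))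

noncomputable def gK (n p k : ℕ) : ℝ := if k = 1 ∧ ¬ p ∣ n then 2 * Real.sqrt p else (p : ℝ) ^ k

noncomputable def wK (n q : ℕ) : ℝ := q.factorization.prod (gK n)

lemma gK_nonneg (n p k : ℕ) : 0 ≤ gK n p k := by
  unfold gK; split_ifs <;> positivity

lemma wK_nonneg (n q : ℕ) : 0 ≤ wK n q := by
  unfold wK Finsupp.prod
  exact Finset.prod_nonneg fun _ _ => gK_nonneg _ _ _

lemma wK_one (n : ℕ) : wK n 1 = 1 := by simp [wK]

lemma wK_mul (n : ℕ) {x y : ℕ} (h : x.Coprime y) : wK n (x * y) = wK n x * wK n y := by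
  unfold wK
  rw [Nat.factorization_mul_of_coprime h, Finsupp.prod_add_index_of_disjoint]
  simpa using h.disjoint_primeFactors

lemma wK_pow (n p k : ℕ) (hp : p.Prime) (hk : k ≠ 0) : wK n (p ^ k) = gK n p k := by
  unfold wK
  rw [hp.factorization_pow, Finsupp.prod, Finsupp.support_single_ne_zero _ hk]
  simp

lemma psi_norm {q : ℕ} [NeZero q] (ψ : AddChar (ZMod q) ℂ) (x : ZMod q) : ‖ψ x‖ = 1 :=
  AddChar.norm_apply ψ x

lemma KS_trivial {q : ℕ} [NeZero q] (ψ : AddChar (ZMod q) ℂ) (n m : ZMod q) : ‖KS ψ n m‖ ≤ q := by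
  unfold KS
  refine (norm_sum_le _ _).trans ?_
  simp only [psi_norm, sum_const, smul_eq_mul, mul_one, nsmul_eq_mul, card_univ]
  rw [ZMod.card_units_eq_totient]
  exact_mod_cast Nat.totient_le q

lemma KS_eq_KSf (p : ℕ) [Fact p.Prime] (ψ : AddChar (ZMod p) ℂ) (n m : ZMod p) : KS ψ n m = KSf ψ n m := by
  unfold KS KSf
  rw [← Finset.sum_subset (Finset.subset_univ (univ.filter (fun x : ZMod p => x ≠ 0)))]
  · rw [Finset.sum_filter]
    rw [← Finset.sum_filter]
    refine Finset.sum_bij (fun x _ => (x : ZMod p)) ?_ ?_ ?_ ?_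
    · intro x _; simp
    · intro x _ y _ h; exact Units.ext h
    · intro y hy
      exact ⟨Units.mk0 y (by simpa using hy), by simp, rfl⟩
    · intro x _
      rw [if_neg x.ne_zero, Units.val_inv_eq_inv_val]
  · intro x _ hx
    have : x = 0 := by simpa using hx
    simp [this]

lemma KS_prime (p : ℕ) [Fact p.Prime] (ψ : AddChar (ZMod p) ℂ) (hψ : ψ.IsPrimitive) (n m : ZMod p) (hn : n ≠ 0) :
    ‖KS ψ n m‖ ≤ 2 * Real.sqrt p := by
  have hp : p.Prime := Fact.out
  have hp1 : (1 : ℝ) ≤ Real.sqrt p := by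
    rw [Real.one_le_sqrt]; exact_mod_cast hp.one_lt.le
  have hψ1 : ψ ≠ 1 := by
    have := hψ (one_ne_zero : (1 : ZMod p) ≠ 0)
    rwa [AddChar.mulShift_one] at this
  by_cases hm : m = 0
  · rw [KS_eq_KSf]
    have : ∀ x : ZMod p, (if x = 0 then 0 else ψ (n * x + m * x⁻¹)) = ψ (x * n) - if x = 0 then 1 else 0 := by
      intro x
      by_cases hx : x = 0
      · simp [hx]
      · simp [hx, hm, mul_comm]
    unfold KSf
    rw [Finset.sum_congr rfl fun x _ => this x, Finset.sum_sub_distrib, AddChar.sum_mulShift _ hψ, if_neg hn]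
    simp
    linarith
  · by_cases h2 : p = 2
    · refine (KS_trivial ψ n m).trans ?_
      have : (p : ℝ) = Real.sqrt p * Real.sqrt p := (Real.mul_self_sqrt (by positivity)).symm
      have h3 : Real.sqrt p ≤ 2 := by
        rw [Real.sqrt_le_left (by norm_num), h2]; norm_num
      nlinarith
    · rw [KS_eq_KSf]
      exact KSf_bound p h2 ψ hψ1 n m hn hm

lemma KS_prime_pow (p k : ℕ) (hp : p.Prime) (hk : 0 < k) (q : ℕ) (hq : q = p ^ k) [NeZero q] (ψ : AddChar (ZMod q) ℂ)
    (hψ : ψ.IsPrimitive) (n : ℕ) (m : ZMod q) :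
    ‖KS ψ n m‖ ≤ gK n p k := by
  unfold gK
  split_ifs with h
  · obtain ⟨rfl, h⟩ := h
    rw [pow_one] at hq
    subst hq
    have : Fact q.Prime := ⟨hp⟩
    refine KS_prime q ψ hψ _ _ ?_
    rwa [Ne, ZMod.natCast_eq_zero_iff]
  · refine (KS_trivial ψ _ m).trans ?_
    rw [hq]; push_cast; exact le_rfl

lemma KS_mul (x y : ℕ) [NeZero x] [NeZero y] [NeZero (x * y)] (h : x.Coprime y) (ψ : AddChar (ZMod (x * y)) ℂ)
    (hψ : ψ.IsPrimitive) (m : ZMod (x * y)) :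
    ∃ (ψ₁ : AddChar (ZMod x) ℂ) (ψ₂ : AddChar (ZMod y) ℂ) (m₁ : ZMod x) (m₂ : ZMod y), ψ₁.IsPrimitive ∧ ψ₂.IsPrimitive ∧
      ∀ n : ℕ, KS ψ n m = KS ψ₁ n m₁ * KS ψ₂ n m₂ := by
  let e := ZMod.chineseRemainder h
  let ψ₁ : AddChar (ZMod x) ℂ := ψ.compAddMonoidHom (e.symm.toAddMonoidHom.comp (AddMonoidHom.inl (ZMod x) (ZMod y)))
  let ψ₂ : AddChar (ZMod y) ℂ := ψ.compAddMonoidHom (e.symm.toAddMonoidHom.comp (AddMonoidHom.inr (ZMod x) (ZMod y)))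
  have h1 : ∀ z, ψ₁ z = ψ (e.symm (z, 0)) := fun z => rfl
  have h2 : ∀ z, ψ₂ z = ψ (e.symm (0, z)) := fun z => rfl
  refine ⟨ψ₁, ψ₂, (e m).1, (e m).2, ?_, ?_, ?_⟩
  · intro a ha hc
    refine hψ (a := e.symm (a, 0)) ?_ ?_
    · intro h0
      apply ha
      have := (map_eq_zero_iff e.symm e.symm.injective).1 h0
      simpa using this
    · ext z
      have := DFunLike.congr_fun hc (e z).1
      rw [AddChar.mulShift_apply, h1] at this
      have hz : e.symm (a, 0) * z = e.symm (a * (e z).1, 0) := by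
        apply e.injective
        ext <;> simp
      rw [AddChar.mulShift_apply, hz, this]
      rfl
  · intro a ha hc
    refine hψ (a := e.symm (0, a)) ?_ ?_
    · intro h0
      apply ha
      have := (map_eq_zero_iff e.symm e.symm.injective).1 h0
      simpa using this
    · ext z
      have := DFunLike.congr_fun hc (e z).2
      rw [AddChar.mulShift_apply, h2] at this
      have hz : e.symm (0, a) * z = e.symm (0, a * (e z).2) := by
        apply e.injective
        ext <;> simp
      rw [AddChar.mulShift_apply, hz, this]
      rfl
  · intro n
    have key : ∀ z, ψ z = ψ₁ (e z).1 * ψ₂ (e z).2 := by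
      intro z
      rw [h1, h2, ← AddChar.map_add_eq_mul, ← map_add]
      simp
    let E : (ZMod (x * y))ˣ ≃* (ZMod x)ˣ × (ZMod y)ˣ := (Units.mapEquiv e.toMulEquiv).trans MulEquiv.prodUnits
    unfold KS
    rw [Finset.sum_mul_sum, ← Finset.sum_product']
    rw [Finset.univ_product_univ]
    refine Fintype.sum_equiv E.toEquiv _ _ ?_
    intro u
    rw [key]
    have e1 : ∀ u, ((E u).1 : ZMod x) = (e u).1 := fun u => rfl
    have e2 : ∀ u, ((E u).2 : ZMod y) = (e u).2 := fun u => rfl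
    have e3 : (E.toEquiv u).1⁻¹ = (E u⁻¹).1 := by rw [map_inv]; rfl
    have e4 : (E.toEquiv u).2⁻¹ = (E u⁻¹).2 := by rw [map_inv]; rfl
    rw [e3, e4, e1, e2]
    change _ = ψ₁ (n * (e u).1 + _) * ψ₂ (n * (e u).2 + _)
    simp

theorem KS_bound (n : ℕ) (q : ℕ) : ∀ [NeZero q] (ψ : AddChar (ZMod q) ℂ), ψ.IsPrimitive → ∀ m : ZMod q, ‖KS ψ n m‖ ≤ wK n q := by
  induction q using Nat.recOnPosPrimePosCoprime with
  | prime_pow p k hp hk =>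
    intro _ ψ hψ m
    rw [wK_pow n p k hp hk.ne']
    exact KS_prime_pow p k hp hk _ rfl ψ hψ n m
  | zero => intro h; exact absurd rfl h.out
  | one =>
    intro _ ψ hψ m
    rw [wK_one]
    simpa using KS_trivial ψ n m
  | coprime x y hx hy h ihx ihy =>
    intro _ ψ hψ m
    have : NeZero x := ⟨by omega⟩
    have : NeZero y := ⟨by omega⟩
    obtain ⟨ψ₁, ψ₂, m₁, m₂, hp1, hp2, H⟩ := KS_mul x y h ψ hψ m
    rw [H, norm_mul, wK_mul n h]
    exact mul_le_mul (ihx ψ₁ hp1 m₁) (ihy ψ₂ hp2 m₂) (norm_nonneg _) (wK_nonneg _ _)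


lemma primefac_sum (ε : ℝ) (hε : 0 < ε) : ∃ P : ℝ, ∀ n : ℕ, 0 < n →
    ∑ p ∈ n.primeFactors, (p : ℝ) ^ (-(1 / 2) : ℝ) ≤ P + ε * Real.log n := by
  have ht : Filter.Tendsto (fun p : ℕ => (p : ℝ) ^ (-(1 / 2) : ℝ)) Filter.atTop (nhds 0) :=
    (tendsto_rpow_neg_atTop (by norm_num : (0 : ℝ) < 1 / 2)).comp tendsto_natCast_atTop_atTop
  have hl : 0 < ε * Real.log 2 := by have := Real.log_pos (by norm_num : (1 : ℝ) < 2); positivity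
  obtain ⟨P0, hP0⟩ := Filter.eventually_atTop.1 (ht.eventually (gt_mem_nhds hl))
  refine ⟨P0, fun n hn => ?_⟩
  have h1 : ∀ p ∈ n.primeFactors, (p : ℝ) ^ (-(1 / 2) : ℝ) ≤ (if p < P0 then 1 else 0) + ε * Real.log p := by
    intro p hp
    have hp' := Nat.prime_of_mem_primeFactors hp
    have hp2 : (2 : ℝ) ≤ p := by exact_mod_cast hp'.two_le
    have hlog : Real.log 2 ≤ Real.log p := Real.log_le_log (by norm_num) hp2
    split_ifs with h
    · have : (p : ℝ) ^ (-(1 / 2) : ℝ) ≤ 1 := Real.rpow_le_one_of_one_le_of_nonpos (by linarith) (by norm_num)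
      have : 0 ≤ ε * Real.log p := mul_nonneg hε.le (Real.log_nonneg (by linarith))
      linarith
    · have := hP0 p (not_lt.1 h)
      have : ε * Real.log 2 ≤ ε * Real.log p := mul_le_mul_of_nonneg_left hlog hε.le
      linarith
  refine (Finset.sum_le_sum h1).trans ?_
  rw [Finset.sum_add_distrib, ← Finset.mul_sum]
  refine add_le_add ?_ (mul_le_mul_of_nonneg_left ?_ hε.le)
  · rw [← Finset.sum_filter, Finset.sum_const, nsmul_eq_mul, mul_one]
    have : (n.primeFactors.filter (fun p => p < P0)) ⊆ Finset.range P0 := by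
      intro p hp; simp at hp ⊢; exact hp.2
    exact_mod_cast (Finset.card_le_card this).trans (by simp)
  · rw [← Real.log_prod (fun p hp => by exact_mod_cast (Nat.prime_of_mem_primeFactors hp).ne_zero)]
    apply Real.log_le_log
    · exact Finset.prod_pos fun p hp => by exact_mod_cast (Nat.prime_of_mem_primeFactors hp).pos
    · rw [← Nat.cast_prod]
      exact_mod_cast Nat.le_of_dvd hn (Nat.prod_primeFactors_dvd n)

lemma euler_factor (ε : ℝ) (hε : 0 < ε) (n p : ℕ) (hp : p.Prime) :
    ∃ t, HasSum (fun k : ℕ => wK n (p ^ k) * ((p ^ k : ℕ) : ℝ) ^ (-(3 / 2) - 2 * ε)) t ∧ 0 ≤ t ∧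
      t ≤ Real.exp (6 * (p : ℝ) ^ (-1 - 2 * ε) + if p ∣ n then (p : ℝ) ^ (-(1 / 2) : ℝ) else 0) := by
  have hp2 : (2 : ℝ) ≤ p := by exact_mod_cast hp.two_le
  have hp0 : (0 : ℝ) < p := by linarith
  set r : ℝ := (p : ℝ) ^ (-(1 / 2) - 2 * ε) with hr
  have hr0 : 0 < r := Real.rpow_pos_of_pos hp0 _
  have hrle : r ≤ (p : ℝ) ^ (-(1 / 2) : ℝ) := Real.rpow_le_rpow_of_exponent_le (by linarith) (by linarith)
  have hs2 : ((2 : ℝ)) ^ (-(1 / 2) : ℝ) ≤ 3 / 4 := by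
    have h1 : 0 ≤ ((2 : ℝ)) ^ (-(1 / 2) : ℝ) := by positivity
    have h2 : ((2 : ℝ)) ^ (-(1 / 2) : ℝ) * ((2 : ℝ)) ^ (-(1 / 2) : ℝ) = 1 / 2 := by
      rw [← Real.rpow_add (by norm_num)]; norm_num [Real.rpow_neg_one]
    nlinarith
  have hr34 : r ≤ 3 / 4 := by
    refine hrle.trans (le_trans ?_ hs2)
    exact Real.rpow_le_rpow_of_nonpos (by norm_num) hp2 (by norm_num)
  have hr2 : r * r ≤ (p : ℝ) ^ (-1 - 2 * ε) := by
    rw [hr, ← Real.rpow_add hp0]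
    exact Real.rpow_le_rpow_of_exponent_le (by linarith) (by linarith)
  have hgeo : HasSum (fun k : ℕ => r ^ k * (r * r)) ((1 - r)⁻¹ * (r * r)) :=
    (hasSum_geometric_of_lt_one hr0.le (by linarith)).mul_right _
  have hterm : ∀ k : ℕ, ((p ^ k : ℕ) : ℝ) ^ (-(3 / 2) - 2 * ε) = (p : ℝ) ^ ((-(3 / 2) - 2 * ε) * k) := by
    intro k
    push_cast
    rw [← Real.rpow_natCast, ← Real.rpow_mul hp0.le, mul_comm]
  have hpr : ∀ k : ℕ, (p : ℝ) ^ k * (p : ℝ) ^ ((-(3 / 2) - 2 * ε) * k) = r ^ k := by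
    intro k
    rw [hr, ← Real.rpow_natCast, ← Real.rpow_natCast, ← Real.rpow_add hp0, ← Real.rpow_mul hp0.le]
    congr 1; ring
  set f := (fun k : ℕ => wK n (p ^ k) * ((p ^ k : ℕ) : ℝ) ^ (-(3 / 2) - 2 * ε)) with hf
  have hf2 : (fun k => f (k + 2)) = fun k => r ^ k * (r * r) := by
    ext k
    simp only [hf]
    rw [wK_pow n p _ hp (by omega), hterm, gK, if_neg (by omega), hpr]
    ring
  have hsum := (hasSum_nat_add_iff (f := f) 2).1 (by rw [show (fun n => f (n + 2)) = fun k => r ^ k * (r * r) from hf2]; exact hgeo)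
  refine ⟨_, hsum, ?_, ?_⟩
  · refine hsum.nonneg fun k => mul_nonneg (wK_nonneg _ _) (by positivity)
  have hinv : (1 - r)⁻¹ ≤ 4 := by
    rw [inv_le_comm₀ (by linarith) (by norm_num)]; linarith
  have h0 : f 0 = 1 := by simp [hf, wK_one]
  have h1 : f 1 ≤ 2 * (p : ℝ) ^ (-1 - 2 * ε) + if p ∣ n then (p : ℝ) ^ (-(1 / 2) : ℝ) else 0 := by
    simp only [hf]
    rw [wK_pow n p _ hp (by omega), hterm, gK]
    have : 0 ≤ (p : ℝ) ^ (-1 - 2 * ε) := by positivity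
    by_cases hd : p ∣ n
    · rw [if_neg (by simp [hd]), hpr, if_pos hd, pow_one]
      linarith
    · rw [if_pos (by simp [hd]), if_neg hd, Real.sqrt_eq_rpow, mul_assoc, ← Real.rpow_add hp0]
      rw [add_zero]
      apply le_of_eq
      congr 2
      push_cast; ring
  refine le_trans ?_ (Real.add_one_le_exp _)
  rw [Finset.sum_range_succ, Finset.sum_range_one, h0]
  have : (1 - r)⁻¹ * (r * r) ≤ 4 * (p : ℝ) ^ (-1 - 2 * ε) :=
    mul_le_mul hinv hr2 (by positivity) (by norm_num)
  linarith

theorem wK_sum (ε : ℝ) (hε : 0 < ε) : ∃ C : ℝ, 0 ≤ C ∧ ∀ n : ℕ, 0 < n →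
    Summable (fun q : ℕ => wK n q * (q : ℝ) ^ (-(3 / 2) - 2 * ε)) ∧
    ∑' q : ℕ, wK n q * (q : ℝ) ^ (-(3 / 2) - 2 * ε) ≤ C * (n : ℝ) ^ ε := by
  obtain ⟨P, hP⟩ := primefac_sum ε hε
  have hsm : Summable (fun m : ℕ => (m : ℝ) ^ (-1 - 2 * ε)) := Real.summable_nat_rpow.2 (by linarith)
  refine ⟨Real.exp (6 * ∑' m : ℕ, (m : ℝ) ^ (-1 - 2 * ε) + P), (Real.exp_pos _).le, fun n hn => ?_⟩
  set f := fun q : ℕ => wK n q * (q : ℝ) ^ (-(3 / 2) - 2 * ε) with hf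
  have hf0 : ∀ q, 0 ≤ f q := fun q => mul_nonneg (wK_nonneg _ _) (by positivity)
  have hf00 : f 0 = 0 := by
    simp only [hf]; rw [Nat.cast_zero, Real.zero_rpow (by linarith), mul_zero]
  have hf1 : f 1 = 1 := by simp [hf, wK_one]
  have hmul : ∀ {x y : ℕ}, x.Coprime y → f (x * y) = f x * f y := by
    intro x y h
    simp only [hf]
    rw [wK_mul n h, Nat.cast_mul, Real.mul_rpow (by positivity) (by positivity)]
    ring
  have hbd : ∀ N : ℕ, ∑ q ∈ range N, f q ≤ Real.exp (6 * ∑' m : ℕ, (m : ℝ) ^ (-1 - 2 * ε) + P) * (n : ℝ) ^ ε := by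
    intro N
    have hsumm : ∀ {p : ℕ}, p.Prime → Summable (fun k : ℕ ↦ ‖f (p ^ k)‖) := by
      intro p hp
      obtain ⟨t, ht, _⟩ := euler_factor ε hε n p hp
      refine ht.summable.congr fun k => ?_
      rw [Real.norm_of_nonneg (hf0 _)]
    obtain ⟨hS, hH⟩ := EulerProduct.summable_and_hasSum_smoothNumbers_prod_primesBelow_tsum hf1 hmul hsumm N
    have h1 : ∑ q ∈ range N, f q ≤ ∏ p ∈ N.primesBelow, ∑' k : ℕ, f (p ^ k) := by
      replace hH := (hasSum_subtype_iff_indicator (f := f) (s := N.smoothNumbers)).1 hH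
      refine le_trans ?_ (sum_le_hasSum (range N) (fun i _ => ?_) hH)
      · refine Finset.sum_le_sum fun q hq => ?_
        rcases Nat.eq_zero_or_pos q with rfl | hq0
        · rw [hf00]; exact Set.indicator_nonneg (fun x _ => hf0 x) _
        · rw [Set.indicator_of_mem (Nat.mem_smoothNumbers_of_lt hq0 (by simpa using hq))]
      · exact Set.indicator_nonneg (fun x _ => hf0 x) _
    refine h1.trans ?_
    have h2 : ∏ p ∈ N.primesBelow, ∑' k : ℕ, f (p ^ k) ≤
        ∏ p ∈ N.primesBelow, Real.exp (6 * (p : ℝ) ^ (-1 - 2 * ε) + if p ∣ n then (p : ℝ) ^ (-(1 / 2) : ℝ) else 0) := by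
      refine Finset.prod_le_prod (fun p hp => tsum_nonneg fun k => hf0 _) fun p hp => ?_
      obtain ⟨t, ht, _, ht2⟩ := euler_factor ε hε n p (Nat.prime_of_mem_primesBelow hp)
      rw [ht.tsum_eq]; exact ht2
    refine h2.trans ?_
    have hn0 : (0 : ℝ) < n := by exact_mod_cast hn
    rw [← Real.exp_sum, Real.rpow_def_of_pos hn0, ← Real.exp_add]
    apply Real.exp_le_exp.2
    rw [Finset.sum_add_distrib, ← Finset.mul_sum]
    have h3 : ∑ p ∈ N.primesBelow, (p : ℝ) ^ (-1 - 2 * ε) ≤ ∑' m : ℕ, (m : ℝ) ^ (-1 - 2 * ε) :=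
      hsm.sum_le_tsum _ fun i _ => by positivity
    have h4 : ∑ p ∈ N.primesBelow, (if p ∣ n then (p : ℝ) ^ (-(1 / 2) : ℝ) else 0) ≤ P + ε * Real.log n := by
      refine le_trans ?_ (hP n hn)
      rw [← Finset.sum_filter]
      refine Finset.sum_le_sum_of_subset_of_nonneg ?_ fun i _ _ => by positivity
      intro p hp
      rw [Finset.mem_filter] at hp
      exact Nat.mem_primeFactors.2 ⟨Nat.prime_of_mem_primesBelow hp.1, hp.2, hn.ne'⟩
    linarith
  have hs : Summable f := summable_of_sum_range_le hf0 hbd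
  exact ⟨hs, Real.tsum_le_of_sum_range_le hf0 hbd⟩


/-- Kloosterman sum with the standard character; zero for modulus zero. -/
noncomputable def KN (n m q : ℕ) : ℂ :=
  if h : q = 0 then 0 else
    haveI : NeZero q := ⟨h⟩
    KS (ZMod.stdAddChar (N := q)) n m

lemma KN_eq (n m q : ℕ) [h : NeZero q] : KN n m q = KS (ZMod.stdAddChar (N := q)) n m := by
  unfold KN; rw [dif_neg h.out]

lemma KN_zero (n m : ℕ) : KN n m 0 = 0 := by simp [KN]

lemma KN_bound (n m q : ℕ) : ‖KN n m q‖ ≤ wK n q := by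
  rcases Nat.eq_zero_or_pos q with rfl | hq
  · rw [KN_zero, norm_zero]; exact wK_nonneg _ _
  · have : NeZero q := ⟨hq.ne'⟩
    rw [KN_eq]
    exact KS_bound n q _ (ZMod.isPrimitive_stdAddChar q) _

lemma KN_bound_triv (n m q : ℕ) : ‖KN n m q‖ ≤ q := by
  rcases Nat.eq_zero_or_pos q with rfl | hq
  · simp [KN_zero]
  · have : NeZero q := ⟨hq.ne'⟩
    rw [KN_eq]
    exact KS_trivial _ _ _

lemma std_pow (q : ℕ) [NeZero q] (x : ZMod q) (m : ℕ) :
    (ZMod.stdAddChar (N := q)) (m * x) = (ZMod.stdAddChar (N := q) x) ^ m := by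
  rw [← AddChar.map_nsmul_eq_pow, nsmul_eq_mul]

lemma std_prim (q : ℕ) [NeZero q] : IsPrimitiveRoot (ZMod.stdAddChar (N := q) 1) q := by
  have := ZMod.stdAddChar_coe (N := q) 1
  rw [Int.cast_one] at this
  rw [this]
  convert Complex.isPrimitiveRoot_exp q (NeZero.ne q) using 2
  push_cast; ring

lemma cR_prim (m q : ℕ) [NeZero q] : KN m 0 q = ∑ z ∈ primitiveRoots q ℂ, z ^ m := by
  rw [KN_eq]
  unfold KS
  have hinj : Function.Injective (fun x : (ZMod q)ˣ => ZMod.stdAddChar (N := q) (x : ZMod q)) := by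
    intro x y h
    exact Units.ext (ZMod.injective_stdAddChar h)
  have himg : (univ : Finset (ZMod q)ˣ).image (fun x : (ZMod q)ˣ => ZMod.stdAddChar (N := q) (x : ZMod q)) = primitiveRoots q ℂ := by
    apply Finset.eq_of_subset_of_card_le
    · intro z hz
      obtain ⟨x, -, rfl⟩ := Finset.mem_image.1 hz
      rw [mem_primitiveRoots (NeZero.pos q)]
      have h1 : ZMod.stdAddChar (N := q) (x : ZMod q) = (ZMod.stdAddChar (N := q) 1) ^ (x : ZMod q).val := by
        rw [← std_pow]; simp
      simp only [h1]
      exact (std_prim q).pow_of_coprime _ (ZMod.val_coe_unit_coprime x)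
    · rw [Finset.card_image_of_injective _ hinj, (std_prim q).card_primitiveRoots, card_univ, ZMod.card_units_eq_totient]
  rw [← himg, Finset.sum_image (fun x _ y _ h => hinj h)]
  refine Finset.sum_congr rfl fun x _ => ?_
  rw [← std_pow]; simp

lemma sum_cR (m N : ℕ) [NeZero N] : ∑ d ∈ N.divisors, KN m 0 d = if N ∣ m then (N : ℂ) else 0 := by
  classical
  have h1 : ∑ d ∈ N.divisors, KN m 0 d = ∑ d ∈ N.divisors, ∑ z ∈ primitiveRoots d ℂ, z ^ m := by
    refine Finset.sum_congr rfl fun d hd => ?_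
    have : NeZero d := ⟨(Nat.pos_of_mem_divisors hd).ne'⟩
    exact cR_prim m d
  rw [h1, ← Finset.sum_biUnion (fun x _ y _ h => IsPrimitiveRoot.disjoint h), ← IsPrimitiveRoot.nthRoots_one_eq_biUnion_primitiveRoots]
  have himg : (univ : Finset (ZMod N)).image (fun x => ZMod.stdAddChar (N := N) x) = Polynomial.nthRootsFinset N (1 : ℂ) := by
    apply Finset.eq_of_subset_of_card_le
    · intro z hz
      obtain ⟨x, -, rfl⟩ := Finset.mem_image.1 hz
      rw [Polynomial.mem_nthRootsFinset (NeZero.pos N)]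
      rw [← std_pow]; simp
    · rw [Finset.card_image_of_injective _ ZMod.injective_stdAddChar, (std_prim N).card_nthRootsFinset, card_univ, ZMod.card]
  rw [← himg, Finset.sum_image (fun x _ y _ h => ZMod.injective_stdAddChar h)]
  have := AddChar.sum_mulShift (m : ZMod N) (ZMod.isPrimitive_stdAddChar N)
  simp only [ZMod.natCast_eq_zero_iff, ZMod.card] at this
  push_cast at this
  rw [← this]
  refine Finset.sum_congr rfl fun x _ => ?_
  rw [← std_pow, mul_comm]

lemma ram_summable (m : ℕ) (b : ℝ) (hb : 1 < b) : Summable (fun q : ℕ => KN m 0 q * (((q : ℝ) ^ (-b - 1) : ℝ) : ℂ)) := by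
  refine Summable.of_norm_bounded (g := fun q : ℕ => (q : ℝ) ^ (-b)) (Real.summable_nat_rpow.2 (by linarith)) fun q => ?_
  rcases Nat.eq_zero_or_pos q with rfl | hq
  · rw [KN_zero]; simp; positivity
  have hq0 : (0 : ℝ) < q := by exact_mod_cast hq
  rw [norm_mul, Complex.norm_real, Real.norm_of_nonneg (by positivity)]
  refine (mul_le_mul_of_nonneg_right (KN_bound_triv m 0 q) (by positivity)).trans ?_
  apply le_of_eq
  rw [sub_eq_add_neg, Real.rpow_add hq0, Real.rpow_neg_one]
  field_simp

theorem ramanujan (m : ℕ) (hm : 0 < m) (b : ℝ) (hb : 1 < b) :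
    ((sigmaR b m : ℝ) : ℂ) = riemannZeta (b + 1 : ℂ) * (((m : ℝ) ^ b : ℝ) : ℂ) *
      ∑' q : ℕ, KN m 0 q * (((q : ℝ) ^ (-b - 1) : ℝ) : ℂ) := by
  have hterm : ∀ f : ℕ → ℂ, ∀ q : ℕ, LSeries.term f (b + 1 : ℂ) q = if q = 0 then 0 else f q * (((q : ℝ) ^ (-b - 1) : ℝ) : ℂ) := by
    intro f q
    rw [LSeries.term_def]
    split_ifs with h
    · rfl
    · rw [div_eq_mul_inv, ← Complex.cpow_neg]
      congr 1
      rw [Complex.ofReal_cpow (by positivity)]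
      push_cast
      congr 1; ring
  have hterm2 : LSeries.term (KN m 0) (b + 1 : ℂ) = fun q : ℕ => KN m 0 q * (((q : ℝ) ^ (-b - 1) : ℝ) : ℂ) := by
    ext q
    rw [hterm]
    split_ifs with h
    · rw [h, KN_zero, zero_mul]
    · rfl
  have hs : LSeriesSummable (KN m 0) (b + 1 : ℂ) := by
    unfold LSeriesSummable; rw [hterm2]; exact ram_summable m b hb
  have hre : 1 < (b + 1 : ℂ).re := by simp; linarith
  have h1 := LSeries_convolution' (LSeriesSummable_one_iff.2 hre) hs
  rw [LSeries_one_eq_riemannZeta hre] at h1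
  have h2 : LSeries (KN m 0) (b + 1 : ℂ) = ∑' q : ℕ, KN m 0 q * (((q : ℝ) ^ (-b - 1) : ℝ) : ℂ) := by
    unfold LSeries; rw [hterm2]
  rw [h2] at h1
  have h3 : LSeries (LSeries.convolution 1 (KN m 0)) (b + 1 : ℂ) = ((∑ d ∈ m.divisors, (d : ℝ) ^ (-b) : ℝ) : ℂ) := by
    unfold LSeries
    rw [tsum_eq_sum (s := m.divisors)]
    · rw [Complex.ofReal_sum]
      refine Finset.sum_congr rfl fun d hd => ?_
      have hd0 := Nat.pos_of_mem_divisors hd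
      have : NeZero d := ⟨hd0.ne'⟩
      have hdr : (0 : ℝ) < d := by exact_mod_cast hd0
      rw [hterm, if_neg hd0.ne', LSeries.convolution_def]
      simp only [Pi.one_apply, one_mul]
      rw [Nat.sum_divisorsAntidiagonal (fun _ y => KN m 0 y), Nat.sum_div_divisors d (fun y => KN m 0 y), sum_cR, if_pos (Nat.dvd_of_mem_divisors hd)]
      rw [sub_eq_add_neg, Real.rpow_add hdr, Real.rpow_neg_one]
      push_cast
      have : (d : ℂ) ≠ 0 := by exact_mod_cast hd0.ne'
      field_simp
    · intro d hd
      rw [hterm]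
      split_ifs with h
      · rfl
      · have : NeZero d := ⟨h⟩
        rw [LSeries.convolution_def]
        simp only [Pi.one_apply, one_mul]
        rw [Nat.sum_divisorsAntidiagonal (fun _ y => KN m 0 y), Nat.sum_div_divisors d (fun y => KN m 0 y), sum_cR, if_neg, zero_mul]
        intro hdm
        exact hd (Nat.mem_divisors.2 ⟨hdm, hm.ne'⟩)
  rw [h3] at h1
  rw [mul_right_comm, ← h1, ← Complex.ofReal_mul]
  congr 1
  unfold sigmaR
  rw [Finset.sum_mul, ← Nat.sum_div_divisors]
  refine Finset.sum_congr rfl fun d hd => ?_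
  have hd0 := Nat.pos_of_mem_divisors hd
  rw [Nat.cast_div (Nat.dvd_of_mem_divisors hd) (by exact_mod_cast hd0.ne'), Real.div_rpow (by positivity) (by positivity), Real.rpow_neg (by positivity)]
  ring


/-- Coefficients of the Eisenstein series. -/
noncomputable def Ac (a j : ℕ) : ℂ := if j = 0 then riemannZeta (-(a : ℂ)) / 2 else (ArithmeticFunction.sigma a j : ℂ)

lemma zeta_neg_formula (a : ℕ) (haodd : Odd a) (ha : 3 ≤ a) :
    riemannZeta (-(a : ℂ)) * (-2 * Real.pi * Complex.I) ^ (a + 1) = 2 * (Nat.factorial a : ℂ) * riemannZeta ((a + 1 : ℕ) : ℂ) := by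
  have h1 := riemannZeta_one_sub (s := ((a + 1 : ℕ) : ℂ)) (by
    intro n h
    have : ((a + 1 + n : ℕ) : ℂ) = 0 := by push_cast at h ⊢; rw [h]; ring
    have := Nat.cast_eq_zero.1 this
    omega) (by
    intro h
    have := Nat.cast_eq_one.1 h
    omega)
  rw [show (1 - ((a + 1 : ℕ) : ℂ)) = -(a : ℂ) by push_cast; ring] at h1
  rw [h1, Nat.cast_succ, Complex.Gamma_nat_eq_factorial]
  obtain ⟨l, hl⟩ := haodd
  have hcos : Complex.cos (Real.pi * ((a : ℂ) + 1) / 2) = (-1) ^ (l + 1) := by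
    rw [show (Real.pi * ((a : ℂ) + 1) / 2 : ℂ) = ((l + 1 : ℕ) : ℂ) * Real.pi by rw [hl]; push_cast; ring]
    rw [← Complex.ofReal_natCast, ← Complex.ofReal_mul, ← Complex.ofReal_cos, Real.cos_nat_mul_pi]
    push_cast; rfl
  have hI : (-2 * Real.pi * Complex.I) ^ (a + 1) = (2 * Real.pi : ℂ) ^ (a + 1) * (-1) ^ (l + 1) := by
    rw [show a + 1 = 2 * (l + 1) by omega, pow_mul, pow_mul]
    rw [← mul_pow]
    congr 1
    ring_nf; rw [Complex.I_sq]; ring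
  have hpi : (2 * Real.pi : ℂ) ≠ 0 := by
    simp [Real.pi_ne_zero]
  have hcp : (2 * Real.pi : ℂ) ^ (-((a : ℂ) + 1)) * (2 * Real.pi : ℂ) ^ (a + 1) = 1 := by
    rw [Complex.cpow_neg, ← Nat.cast_succ, Complex.cpow_natCast]
    exact inv_mul_cancel₀ (pow_ne_zero _ hpi)
  rw [hcos, hI]
  have h11 : ((-1 : ℂ) ^ (l + 1)) * (-1) ^ (l + 1) = 1 := by rw [← mul_pow]; simp
  calc _ = 2 * (Nat.factorial a : ℂ) * riemannZeta ((a : ℂ) + 1) * ((2 * Real.pi : ℂ) ^ (-((a : ℂ) + 1)) * (2 * Real.pi : ℂ) ^ (a + 1)) * (((-1 : ℂ) ^ (l + 1)) * (-1) ^ (l + 1)) := by ring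
    _ = _ := by rw [hcp, h11]; ring

lemma zeta_a1_ne (a : ℕ) (ha : 3 ≤ a) : riemannZeta ((a + 1 : ℕ) : ℂ) ≠ 0 :=
  riemannZeta_ne_zero_of_one_lt_re (by
    rw [Complex.natCast_re]; exact_mod_cast (by omega : 1 < a + 1))

open UpperHalfPlane in
lemma Ac_summable (a : ℕ) (τ : ℍ) : Summable (fun j : ℕ => Ac a j * Complex.exp (2 * Real.pi * Complex.I * τ) ^ j) := by
  have := EisensteinSeries.summable_sigma_mul_cexp_pow (k := a + 1) (by omega) τ
  rw [Nat.add_sub_cancel] at this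
  rw [← summable_nat_add_iff 1] at this ⊢
  refine this.congr fun j => ?_
  simp [Ac]

open UpperHalfPlane in
lemma G_eq (a : ℕ) (haodd : Odd a) (ha : 3 ≤ a) (τ : ℍ) :
    ∑' j : ℕ, Ac a j * Complex.exp (2 * Real.pi * Complex.I * τ) ^ j =
      riemannZeta (-(a : ℂ)) / 2 * ModularForm.E (k := a + 1) (by omega) τ := by
  have hE := EisensteinSeries.q_expansion_riemannZeta (k := a + 1) (by omega) haodd.add_one τ
  have hs := Ac_summable a τ
  rw [hs.tsum_eq_zero_add, hE, Nat.add_sub_cancel]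
  have h2 : ∑' n : ℕ+, (ArithmeticFunction.sigma a n : ℂ) * Complex.exp (2 * Real.pi * Complex.I * τ) ^ ((n : ℕ) : ℤ)
      = ∑' j : ℕ, Ac a (j + 1) * Complex.exp (2 * Real.pi * Complex.I * τ) ^ (j + 1) := by
    rw [← tsum_pnat_eq_tsum_succ (f := fun n : ℕ => Ac a n * Complex.exp (2 * Real.pi * Complex.I * τ) ^ n)]
    refine tsum_congr fun n => ?_
    simp [Ac]
  have hz := zeta_neg_formula a haodd ha
  have hz1 := zeta_a1_ne a ha
  have hfac : (Nat.factorial a : ℂ) ≠ 0 := by exact_mod_cast Nat.factorial_ne_zero a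
  rw [h2]
  set S := ∑' j : ℕ, Ac a (j + 1) * Complex.exp (2 * Real.pi * Complex.I * τ) ^ (j + 1)
  have hc : riemannZeta (-(a : ℂ)) / 2 * ((riemannZeta ((a + 1 : ℕ) : ℂ))⁻¹ * (-2 * Real.pi * Complex.I) ^ (a + 1) / (Nat.factorial a : ℂ)) = 1 := by
    field_simp
    linear_combination hz
  rw [mul_add, ← mul_assoc, hc, Ac, if_pos rfl]
  simp

open UpperHalfPlane in
/-- Modular transformation of the additively twisted Lambert series. -/
theorem modular_twist (a : ℕ) (haodd : Odd a) (ha : 3 ≤ a) (q : ℕ) [NeZero q] (h : (ZMod q)ˣ) (z : ℂ) (hz : 0 < z.re) :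
    ∑' j : ℕ, Ac a j * ZMod.stdAddChar (N := q) (-(h : ZMod q) * j) * Complex.exp (-(j * z)) =
      (2 * Real.pi / (Complex.I * q * z)) ^ (a + 1) *
      ∑' m : ℕ, Ac a m * ZMod.stdAddChar (N := q) (((h⁻¹ : (ZMod q)ˣ) : ZMod q) * m) * Complex.exp (-(4 * Real.pi ^ 2 * m / (q ^ 2 * z))) := by
  have hq0 : (q : ℂ) ≠ 0 := by exact_mod_cast NeZero.ne q
  have hqr : (0 : ℝ) < q := by exact_mod_cast NeZero.pos q
  have hz0 : z ≠ 0 := by intro h; rw [h] at hz; simp at hz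
  have hpi : (Real.pi : ℂ) ≠ 0 := by exact_mod_cast Real.pi_ne_zero
  set hv : ℤ := ((h : ZMod q).val : ℤ) with hhv
  set al : ℤ := (((h⁻¹ : (ZMod q)ˣ) : ZMod q).val : ℤ) with hal
  have hhv' : ((hv : ℤ) : ZMod q) = h := by rw [hhv]; simp
  have hal' : ((al : ℤ) : ZMod q) = ((h⁻¹ : (ZMod q)ˣ) : ZMod q) := by rw [hal]; simp
  have hdvd : (q : ℤ) ∣ al * hv - 1 := by
    rw [← ZMod.intCast_eq_intCast_iff_dvd_sub]
    push_cast
    rw [hhv', hal']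
    simp
  obtain ⟨be, hbe⟩ := hdvd
  let γ : Matrix.SpecialLinearGroup (Fin 2) ℤ := ⟨!![al, be; (q : ℤ), hv], by rw [Matrix.det_fin_two_of]; linarith⟩
  let τ : ℍ := ⟨-(hv : ℂ) / q + Complex.I * z / (2 * Real.pi), by
    have h1 : (-(hv : ℂ) / q).im = 0 := by
      rw [show (-(hv : ℂ) / q) = ((-(hv : ℝ) / q : ℝ) : ℂ) by push_cast; ring]; exact Complex.ofReal_im _
    have h2 : (Complex.I * z / (2 * Real.pi)) = Complex.I * (((2 * Real.pi)⁻¹ : ℝ) * z) := by push_cast; field_simp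
    rw [Complex.add_im, h1, h2, Complex.I_mul_im, Complex.re_ofReal_mul]
    have := Real.pi_pos
    positivity⟩
  have hτ : (τ : ℂ) = -(hv : ℂ) / q + Complex.I * z / (2 * Real.pi) := rfl
  have hmod : ModularForm.E (k := a + 1) (by omega : 3 ≤ a + 1) (γ • τ) = ((q : ℂ) * τ + hv) ^ (a + 1) * ModularForm.E (k := a + 1) (by omega) τ := by
    have := SlashInvariantForm.slash_action_eqn'' (ModularForm.E (k := a + 1) (by omega : 3 ≤ a + 1)) (γ := Matrix.SpecialLinearGroup.mapGL ℝ γ) (MonoidHom.mem_range.2 ⟨γ, rfl⟩) τ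
    rw [zpow_natCast] at this
    have h3 : denom (Matrix.SpecialLinearGroup.mapGL ℝ γ) τ = (q : ℂ) * τ + hv := by
      have e10 : ((Matrix.SpecialLinearGroup.mapGL ℝ γ) 1 0 : ℝ) = ((q : ℤ) : ℝ) := rfl
      have e11 : ((Matrix.SpecialLinearGroup.mapGL ℝ γ) 1 1 : ℝ) = (hv : ℝ) := rfl
      rw [denom, e10, e11]
      simp
    rw [h3] at this
    exact this
  have hden : (q : ℂ) * τ + hv = q * Complex.I * z / (2 * Real.pi) := by
    rw [hτ]; field_simp; ring
  have hγτ : ((γ • τ : ℍ) : ℂ) = al / q + 2 * Real.pi * Complex.I / (q ^ 2 * z) := by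
    rw [coe_specialLinearGroup_apply]
    have : (((algebraMap ℤ ℝ (γ 1 0) : ℝ) : ℂ) * τ + ((algebraMap ℤ ℝ (γ 1 1) : ℝ) : ℂ)) = (q : ℂ) * τ + hv := by
      simp [γ]
    rw [this, hden, hτ]
    have hbe' : (al : ℂ) * hv - 1 = q * be := by exact_mod_cast congrArg (Int.cast (R := ℂ)) hbe
    simp [γ]
    field_simp
    linear_combination (-2 * Real.pi : ℂ) * hbe' - 2 * Real.pi * Complex.I_sq
  have e1 : ∀ j : ℕ, ZMod.stdAddChar (N := q) (-(h : ZMod q) * j) * Complex.exp (-(j * z)) = Complex.exp (2 * Real.pi * Complex.I * τ) ^ j := by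
    intro j
    have := ZMod.stdAddChar_coe (N := q) (-hv * j)
    rw [show (((-hv * j : ℤ)) : ZMod q) = -(h : ZMod q) * j by push_cast; rw [hhv']] at this
    rw [this, ← Complex.exp_add, ← Complex.exp_nat_mul, hτ]
    congr 1
    push_cast
    field_simp
    ring_nf
    rw [Complex.I_sq]; ring
  have e2 : ∀ m : ℕ, ZMod.stdAddChar (N := q) (((h⁻¹ : (ZMod q)ˣ) : ZMod q) * m) * Complex.exp (-(4 * Real.pi ^ 2 * m / (q ^ 2 * z))) =
      Complex.exp (2 * Real.pi * Complex.I * (γ • τ : ℍ)) ^ m := by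
    intro m
    have := ZMod.stdAddChar_coe (N := q) (al * m)
    rw [show (((al * m : ℤ)) : ZMod q) = ((h⁻¹ : (ZMod q)ˣ) : ZMod q) * m by push_cast; rw [hal']] at this
    rw [this, ← Complex.exp_add, ← Complex.exp_nat_mul, hγτ]
    congr 1
    push_cast
    field_simp
    ring_nf
    rw [Complex.I_sq]; ring
  have t1 : ∑' j : ℕ, Ac a j * ZMod.stdAddChar (N := q) (-(h : ZMod q) * j) * Complex.exp (-(j * z)) =
      ∑' j : ℕ, Ac a j * Complex.exp (2 * Real.pi * Complex.I * τ) ^ j := by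
    apply tsum_congr
    intro j
    rw [← e1 j, mul_assoc]
  have t2 : ∑' m : ℕ, Ac a m * ZMod.stdAddChar (N := q) (((h⁻¹ : (ZMod q)ˣ) : ZMod q) * m) * Complex.exp (-(4 * Real.pi ^ 2 * m / (q ^ 2 * z))) =
      ∑' m : ℕ, Ac a m * Complex.exp (2 * Real.pi * Complex.I * (γ • τ : ℍ)) ^ m := by
    apply tsum_congr
    intro j
    rw [← e2 j, mul_assoc]
  rw [t1, t2]
  rw [G_eq a haodd ha, G_eq a haodd ha, hmod, hden]
  have : (2 * Real.pi / (Complex.I * q * z)) ^ (a + 1) * (q * Complex.I * z / (2 * Real.pi)) ^ (a + 1) = 1 := by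
    rw [← mul_pow]
    rw [show (2 * Real.pi / (Complex.I * q * z)) * (q * Complex.I * z / (2 * Real.pi)) = 1 by
      have := Complex.I_ne_zero
      field_simp]
    exact one_pow _
  linear_combination (-(riemannZeta (-(a : ℂ)) / 2 * ModularForm.E (k := a + 1) (by omega : 3 ≤ a + 1) τ)) * this

open MeasureTheory

theorem laplace_complex (b : ℝ) (hb : 0 < b) (r : ℂ) (hr : 0 < r.re) :
    ∫ y in Set.Ioi (0:ℝ), ((y ^ b : ℝ) : ℂ) * Complex.exp (-(r * y))
      = (Real.Gamma (b + 1) : ℂ) * r ^ (-((b:ℂ) + 1)) := by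
  set μ : Measure ℝ := (volume.restrict (Set.Ioi (0:ℝ))).withDensity
    (fun y => ENNReal.ofReal (y ^ b)) with hμ
  have hmeas : Measurable (fun y : ℝ => ENNReal.ofReal (y ^ b)) := by fun_prop
  have hlt : ∀ᵐ y ∂(volume.restrict (Set.Ioi (0:ℝ))), ENNReal.ofReal (y ^ b) < ⊤ :=
    Filter.Eventually.of_forall fun y => ENNReal.ofReal_lt_top
  have hset : Set.Iio (0:ℝ) ⊆ ProbabilityTheory.integrableExpSet id μ := by
    intro t ht
    have ht : t < 0 := ht
    have h1 := integrableOn_rpow_mul_exp_neg_mul_rpow (p := 1) (s := b) (b := -t)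
      (by linarith) one_pos (by linarith)
    show Integrable _ μ
    rw [hμ, integrable_withDensity_iff_integrable_smul' hmeas hlt]
    refine IntegrableOn.congr_fun h1 ?_ measurableSet_Ioi
    intro y hy
    have hy : 0 < y := hy
    simp only [Real.rpow_one, neg_neg, id, smul_eq_mul]
    rw [ENNReal.toReal_ofReal (by positivity)]
  have hmgf : ∀ z : ℂ, ProbabilityTheory.complexMGF id μ z
      = ∫ y in Set.Ioi (0:ℝ), ((y ^ b : ℝ) : ℂ) * Complex.exp (z * y) := by
    intro z
    rw [ProbabilityTheory.complexMGF, hμ, integral_withDensity_eq_integral_toReal_smul hmeas hlt]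
    refine setIntegral_congr_fun measurableSet_Ioi fun y hy => ?_
    have hy : 0 < y := hy
    simp only [id]
    rw [ENNReal.toReal_ofReal (by positivity)]
    simp
  have hitg : Set.Iio (0:ℝ) ⊆ interior (ProbabilityTheory.integrableExpSet id μ) :=
    interior_maximal hset isOpen_Iio
  have hX : AnalyticOnNhd ℂ (ProbabilityTheory.complexMGF id μ) {z | z.re < 0} := by
    intro z hz
    exact ProbabilityTheory.analyticOnNhd_complexMGF z (hitg hz)
  have hopen : IsOpen {z : ℂ | z.re < 0} := isOpen_lt Complex.continuous_re continuous_const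
  have hY : AnalyticOnNhd ℂ (fun z : ℂ => (Real.Gamma (b + 1) : ℂ) * (-z) ^ (-((b:ℂ) + 1)))
      {z | z.re < 0} := by
    apply DifferentiableOn.analyticOnNhd _ hopen
    intro z hz
    have hz : z.re < 0 := hz
    apply DifferentiableAt.differentiableWithinAt
    apply DifferentiableAt.const_mul
    apply DifferentiableAt.cpow (by fun_prop) (by fun_prop)
    left
    simpa using hz
  have key := AnalyticOnNhd.eqOn_of_preconnected_of_frequently_eq hX hY
    (convex_halfSpace_re_lt 0).isPreconnected (z₀ := ((-1:ℝ):ℂ)) (by simp) ?_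
  · have := key (show -r ∈ {z : ℂ | z.re < 0} by simpa using hr)
    rw [hmgf] at this
    simpa using this
  have h_real : ∃ᶠ (x : ℝ) in nhdsWithin (-1) {-1}ᶜ, ProbabilityTheory.complexMGF id μ x
      = (Real.Gamma (b + 1) : ℂ) * (-(x:ℂ)) ^ (-((b:ℂ) + 1)) := by
    apply Filter.Eventually.frequently
    apply nhdsWithin_le_nhds
    filter_upwards [Iio_mem_nhds (show (-1:ℝ) < 0 by norm_num)] with x hx
    have hx : x < 0 := hx
    rw [hmgf]
    have h2 := Real.integral_rpow_mul_exp_neg_mul_Ioi (a := b + 1) (r := -x)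
      (by linarith) (by linarith)
    have h3 : (∫ y in Set.Ioi (0:ℝ), ((y ^ b : ℝ) : ℂ) * Complex.exp (x * y))
        = ((∫ y in Set.Ioi (0:ℝ), y ^ (b + 1 - 1) * Real.exp (-(-x * y)) : ℝ) : ℂ) := by
      refine Eq.trans ?_ integral_ofReal
      refine setIntegral_congr_fun measurableSet_Ioi fun y hy => ?_
      simp
    rw [h3, h2]
    have h4 : (-(x:ℂ)) ^ (-((b:ℂ) + 1)) = (((-x) ^ (-(b + 1)) : ℝ) : ℂ) := by
      rw [Complex.ofReal_cpow (by linarith)]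
      push_cast; rfl
    rw [h4, ← Complex.ofReal_mul, one_div, Real.inv_rpow (by linarith), ← Real.rpow_neg (by linarith),
      mul_comm]
  rw [Filter.frequently_iff_seq_forall] at h_real ⊢
  obtain ⟨xs, hx_tendsto, hx_eq⟩ := h_real
  refine ⟨fun n ↦ xs n, ?_, fun n ↦ ?_⟩
  · rw [tendsto_nhdsWithin_iff] at hx_tendsto ⊢
    constructor
    · rw [Filter.tendsto_ofReal_iff]
      exact hx_tendsto.1
    · filter_upwards [hx_tendsto.2] with n hn
      simp only [Set.mem_compl_iff, Set.mem_singleton_iff] at hn ⊢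
      exact_mod_cast hn
  · exact hx_eq n

theorem norm_line (c t : ℝ) : ‖(c:ℂ) + t * Complex.I‖ = Real.sqrt (c^2 + t^2) := by
  rw [Complex.norm_add_mul_I]

theorem norm_line_rpow (c : ℝ) (hc : 0 < c) (β t : ℝ) :
    ‖(c:ℂ) + t * Complex.I‖ ^ (-β) = c ^ (-β) * (1 + ‖t / c‖ ^ 2) ^ (-β/2) := by
  rw [norm_line]
  have h1 : c^2 + t^2 = c^2 * (1 + ‖t / c‖ ^ 2) := by
    rw [Real.norm_eq_abs, sq_abs]; field_simp
  rw [h1, Real.sqrt_mul (by positivity), Real.sqrt_sq hc.le, Real.mul_rpow hc.le (by positivity)]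
  congr 1
  rw [Real.sqrt_eq_rpow, ← Real.rpow_mul (by positivity)]
  congr 1; ring

theorem line_integrable (c : ℝ) (hc : 0 < c) (β : ℝ) (hβ : 1 < β) :
    Integrable (fun t : ℝ => ‖(c:ℂ) + t * Complex.I‖ ^ (-β)) := by
  simp_rw [norm_line_rpow c hc]
  have h := integrable_rpow_neg_one_add_norm_sq (E := ℝ) (μ := volume) (r := β) (by simpa using hβ)
  exact (h.comp_div hc.ne').const_mul _

theorem line_integral (c : ℝ) (hc : 0 < c) (β : ℝ) :
    ∫ t : ℝ, ‖(c:ℂ) + t * Complex.I‖ ^ (-β)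
      = c ^ (1 - β) * ∫ u : ℝ, (1 + ‖u‖ ^ 2) ^ (-β/2) := by
  simp_rw [norm_line_rpow c hc]
  rw [integral_const_mul, Measure.integral_comp_div (fun u : ℝ => (1 + ‖u‖ ^ 2) ^ (-β/2)), abs_of_pos hc,
    smul_eq_mul, ← mul_assoc]
  congr 1
  rw [show (1 - β) = -β + 1 by ring, Real.rpow_add_one hc.ne']

theorem line_ne (c : ℝ) (hc : 0 < c) (t : ℝ) : (c:ℂ) + t * Complex.I ≠ 0 := by
  intro h
  have := congrArg Complex.re h
  simp at this; linarith

theorem norm_line_cpow (c : ℝ) (hc : 0 < c) (β t : ℝ) :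
    ‖((c:ℂ) + t * Complex.I) ^ (-(β:ℂ))‖ = ‖(c:ℂ) + t * Complex.I‖ ^ (-β) := by
  rw [← Complex.norm_cpow_real, ← Complex.ofReal_neg]

theorem line_cpow_cont (c : ℝ) (hc : 0 < c) (β : ℂ) :
    Continuous (fun t : ℝ => ((c:ℂ) + t * Complex.I) ^ (-β)) := by
  refine continuous_iff_continuousAt.2 fun t => ?_
  apply ContinuousAt.cpow (by fun_prop) (by fun_prop)
  left; simpa using hc

theorem line_cpow_integrable (c : ℝ) (hc : 0 < c) (β : ℝ) (hβ : 1 < β) :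
    Integrable (fun t : ℝ => ((c:ℂ) + t * Complex.I) ^ (-(β:ℂ))) := by
  refine Integrable.mono' (line_integrable c hc β hβ)
    (line_cpow_cont c hc β).aestronglyMeasurable ?_
  exact Filter.Eventually.of_forall fun t => (norm_line_cpow c hc β t).le

theorem perron (c : ℝ) (hc : 0 < c) (b : ℝ) (hb : 0 < b) (x : ℝ) :
    ∫ t : ℝ, Complex.exp (x * (c + t * Complex.I)) * ((c:ℂ) + t * Complex.I) ^ (-((b + 1 : ℝ):ℂ))
      = 2 * Real.pi / Real.Gamma (b + 1) * (if 0 < x then ((x ^ b : ℝ) : ℂ) else 0) := by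
  have hG : 0 < Real.Gamma (b+1) := Real.Gamma_pos_of_pos (by linarith)
  have hpi := Real.pi_pos
  set f : ℝ → ℂ := fun y => (((max y 0) ^ b * Real.exp (-(c * y)) : ℝ) : ℂ) with hf
  have hfind : f = Set.indicator (Set.Ioi 0) (fun y => ((y ^ b * Real.exp (-(c * y)) : ℝ) : ℂ)) := by
    funext y
    by_cases hy : 0 < y
    · rw [Set.indicator_of_mem (by exact hy)]
      simp [hf, max_eq_left hy.le]
    · rw [Set.indicator_of_notMem (by exact hy)]
      simp [hf, max_eq_right (not_lt.1 hy), Real.zero_rpow hb.ne']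
  have hfc : Continuous f := by
    apply Complex.continuous_ofReal.comp
    apply Continuous.mul
    · exact (continuous_id.max continuous_const).rpow_const (fun _ => Or.inr hb.le)
    · fun_prop
  have hfi : Integrable f := by
    rw [hfind, integrable_indicator_iff measurableSet_Ioi]
    apply Integrable.ofReal
    have h1 := integrableOn_rpow_mul_exp_neg_mul_rpow (p := 1) (s := b) (b := c)
      (by linarith) one_pos hc
    refine IntegrableOn.congr_fun h1 ?_ measurableSet_Ioi
    intro y hy
    show y ^ b * Real.exp (-c * y ^ (1:ℝ)) = y ^ b * Real.exp (-(c * y))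
    rw [Real.rpow_one, neg_mul]
  have hF : ∀ ξ : ℝ, FourierTransform.fourier f ξ
      = (Real.Gamma (b + 1) : ℂ) * ((c:ℂ) + (2 * Real.pi * ξ : ℝ) * Complex.I) ^ (-((b + 1 : ℝ):ℂ)) := by
    intro ξ
    rw [Real.fourier_real_eq_integral_exp_smul]
    have h := laplace_complex b hb ((c:ℂ) + (2 * Real.pi * ξ : ℝ) * Complex.I) (by simpa using hc)
    push_cast at h ⊢
    rw [← h, ← integral_indicator measurableSet_Ioi]
    congr 1
    funext y
    rw [hfind]
    by_cases hy : 0 < y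
    · rw [Set.indicator_of_mem (by exact hy), Set.indicator_of_mem (by exact hy), smul_eq_mul]
      push_cast
      rw [mul_left_comm, ← Complex.exp_add]
      congr 2
      ring
    · rw [Set.indicator_of_notMem (by exact hy), Set.indicator_of_notMem (by exact hy), smul_zero]
  have hFi : Integrable (FourierTransform.fourier f) := by
    have h1 := ((line_cpow_integrable c hc (b+1) (by linarith)).comp_mul_left'
      (show 2 * Real.pi ≠ 0 by positivity)).const_mul (Real.Gamma (b + 1) : ℂ)
    refine h1.congr (Filter.Eventually.of_forall fun ξ => ?_)
    rw [hF]
  have hinv := congrFun (hfc.fourierInv_fourier_eq hfi hFi) x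
  rw [Real.fourierInv_eq'] at hinv
  simp_rw [hF] at hinv
  have hcv := Measure.integral_comp_mul_left (fun t : ℝ => Complex.exp (x * t * Complex.I) *
    ((Real.Gamma (b + 1) : ℂ) * ((c:ℂ) + t * Complex.I) ^ (-((b + 1 : ℝ):ℂ)))) (2 * Real.pi)
  have e1 : (∫ v : ℝ, Complex.exp (((2 * Real.pi * inner ℝ v x : ℝ):ℂ) * Complex.I) •
      ((Real.Gamma (b + 1) : ℂ) * ((c:ℂ) + (2 * Real.pi * v : ℝ) * Complex.I) ^ (-((b + 1 : ℝ):ℂ))))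
      = ∫ v : ℝ, Complex.exp (x * (2 * Real.pi * v : ℝ) * Complex.I) *
    ((Real.Gamma (b + 1) : ℂ) * ((c:ℂ) + (2 * Real.pi * v : ℝ) * Complex.I) ^ (-((b + 1 : ℝ):ℂ))) := by
    congr 1
    funext v
    rw [smul_eq_mul]
    congr 2
    simp
    ring
  rw [e1, hcv] at hinv
  have e2 : (∫ t : ℝ, Complex.exp (x * (c + t * Complex.I)) * ((c:ℂ) + t * Complex.I) ^ (-((b + 1 : ℝ):ℂ)))
      = Complex.exp (x * c) / Real.Gamma (b+1) * ∫ t : ℝ, Complex.exp (x * t * Complex.I) *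
    ((Real.Gamma (b + 1) : ℂ) * ((c:ℂ) + t * Complex.I) ^ (-((b + 1 : ℝ):ℂ))) := by
    rw [← integral_const_mul]
    congr 1
    funext t
    have : (Real.Gamma (b+1) : ℂ) ≠ 0 := by exact_mod_cast hG.ne'
    rw [mul_add, Complex.exp_add]
    field_simp
  rw [e2]
  have e3 : (∫ t : ℝ, Complex.exp (x * t * Complex.I) *
    ((Real.Gamma (b + 1) : ℂ) * ((c:ℂ) + t * Complex.I) ^ (-((b + 1 : ℝ):ℂ)))) = 2 * Real.pi * f x := by
    rw [← hinv, abs_of_pos (by positivity), Complex.real_smul, ← mul_assoc]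
    have : (2 * Real.pi : ℂ) * (((2 * Real.pi)⁻¹ : ℝ) : ℂ) = 1 := by
      have : (Real.pi : ℂ) ≠ 0 := by exact_mod_cast hpi.ne'
      push_cast
      field_simp
    rw [this, one_mul]
  rw [e3, hfind]
  by_cases hx : 0 < x
  · rw [Set.indicator_of_mem (by exact hx), if_pos hx]
    push_cast
    have : Complex.exp (x * c) * Complex.exp (-(c * x)) = 1 := by
      rw [← Complex.exp_add]; simp [mul_comm]
    linear_combination (2 * Real.pi / Real.Gamma (b + 1) * ((x^b : ℝ) : ℂ)) * this
  · rw [Set.indicator_of_notMem (by exact hx), if_neg hx]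
    simp

open MeasureTheory

lemma Ac_norm_summable (a : ℕ) (c : ℝ) (hc : 0 < c) :
    Summable (fun j : ℕ => ‖Ac a j‖ * Real.exp (-(j * c))) := by
  have hpi := Real.pi_pos
  have h := (Ac_summable a ⟨((c / (2 * Real.pi) : ℝ) : ℂ) * Complex.I, by
    simp only [Complex.mul_im, Complex.ofReal_re, Complex.ofReal_im, Complex.I_re, Complex.I_im]
    positivity⟩).norm
  refine h.congr fun j => ?_
  rw [norm_mul, norm_pow, Complex.norm_exp, ← Real.exp_nat_mul]
  congr 2
  have : 2 * (Real.pi:ℂ) * Complex.I * (((c / (2 * Real.pi) : ℝ) : ℂ) * Complex.I) = ((-c : ℝ) : ℂ) := by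
    have : (Real.pi : ℂ) ≠ 0 := by exact_mod_cast hpi.ne'
    push_cast
    field_simp
    linear_combination Complex.I_sq * c
  show _ * (2 * (Real.pi:ℂ) * Complex.I * (((c / (2 * Real.pi) : ℝ) : ℂ) * Complex.I)).re = _
  rw [this, Complex.ofReal_re]; ring

lemma Ac_summable_w (a : ℕ) (u : ℕ → ℂ) (M : ℝ) (hu : ∀ j, ‖u j‖ ≤ M) (w : ℂ) (hw : 0 < w.re) :
    Summable (fun j : ℕ => Ac a j * u j * Complex.exp (-(j * w))) := by
  refine Summable.of_norm_bounded ((Ac_norm_summable a w.re hw).mul_left M) fun j => ?_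
  rw [norm_mul, norm_mul, Complex.norm_exp]
  have : (-((j:ℂ) * w)).re = -(j * w.re) := by simp
  rw [this]
  have := hu j
  calc ‖Ac a j‖ * ‖u j‖ * Real.exp (-(j * w.re)) ≤ ‖Ac a j‖ * M * Real.exp (-(j * w.re)) := by gcongr
    _ = _ := by ring

lemma Ac_bound (a : ℕ) (ha : 3 ≤ a) : ∃ K : ℝ, 0 ≤ K ∧ ∀ m : ℕ, 0 < m → ‖Ac a m‖ ≤ K * (m:ℝ) ^ a := by
  have hs : Summable (fun d : ℕ => 1 / (d:ℝ) ^ a) := Real.summable_one_div_nat_pow.2 (by omega)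
  refine ⟨∑' d : ℕ, 1 / (d:ℝ) ^ a, tsum_nonneg fun d => by positivity, fun m hm => ?_⟩
  rw [Ac, if_neg hm.ne', ArithmeticFunction.sigma_apply]
  have : ‖((∑ d ∈ m.divisors, d ^ a : ℕ) : ℂ)‖ = ∑ d ∈ m.divisors, (d:ℝ) ^ a := by
    rw [Complex.norm_natCast]; push_cast; rfl
  rw [this, ← Nat.sum_div_divisors, mul_comm]
  calc ∑ d ∈ m.divisors, ((m / d : ℕ):ℝ) ^ a = ∑ d ∈ m.divisors, (m:ℝ)^a * (1 / (d:ℝ) ^ a) := by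
        refine Finset.sum_congr rfl fun d hd => ?_
        have hd' := Nat.dvd_of_mem_divisors hd
        have : d ≠ 0 := (Nat.pos_of_mem_divisors hd).ne'
        rw [Nat.cast_div hd' (by exact_mod_cast this), div_pow]; ring
    _ = (m:ℝ)^a * ∑ d ∈ m.divisors, (1 / (d:ℝ) ^ a) := by rw [Finset.mul_sum]
    _ ≤ _ := by
        gcongr
        exact hs.sum_le_tsum _ fun d _ => by positivity

lemma step1 (a n : ℕ) (hn : 0 < n) (b : ℝ) (hb : 0 < b) (u : ℕ → ℂ) (M : ℝ) (hu : ∀ j, ‖u j‖ ≤ M)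
    (c : ℝ) (hc : 0 < c) :
    (∑ j ∈ Finset.range n, Ac a j * u j * (((((n - j : ℕ) : ℝ)) ^ b : ℝ) : ℂ))
      * (2 * Real.pi / Real.Gamma (b + 1)) =
    ∫ t : ℝ, (∑' j : ℕ, Ac a j * u j * Complex.exp (-(j * ((c:ℂ) + t * Complex.I))))
      * (Complex.exp (n * (c + t * Complex.I)) * ((c:ℂ) + t * Complex.I) ^ (-((b + 1 : ℝ):ℂ))) := by
  set F : ℕ → ℝ → ℂ := fun j t => Ac a j * u j * (Complex.exp (((n - j : ℝ) : ℝ) * (c + t * Complex.I)) *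
    ((c:ℂ) + t * Complex.I) ^ (-((b + 1 : ℝ):ℂ))) with hF
  have hnorm : ∀ x t : ℝ, ‖Complex.exp (x * (c + t * Complex.I)) *
    ((c:ℂ) + t * Complex.I) ^ (-((b + 1 : ℝ):ℂ))‖ = Real.exp (x * c) * ‖(c:ℂ) + t * Complex.I‖ ^ (-(b+1)) := by
    intro x t
    rw [norm_mul, norm_line_cpow c hc, Complex.norm_exp]
    simp
  have hitg0 : ∀ x : ℝ, Integrable (fun t : ℝ => Complex.exp (x * (c + t * Complex.I)) *
    ((c:ℂ) + t * Complex.I) ^ (-((b + 1 : ℝ):ℂ))) := by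
    intro x
    refine Integrable.mono' ((line_integrable c hc (b+1) (by linarith)).const_mul (Real.exp (x * c))) ?_ ?_
    · exact (Continuous.mul (by fun_prop) (line_cpow_cont c hc _)).aestronglyMeasurable
    · exact Filter.Eventually.of_forall fun t => (hnorm x t).le
  have hitg : ∀ j, Integrable (F j) := fun j => (hitg0 _).const_mul _
  have hM : 0 ≤ M := (norm_nonneg _).trans (hu 0)
  have hsum : Summable (fun j => ∫ t, ‖F j t‖) := by
    have : ∀ j, ∫ t, ‖F j t‖ = ‖Ac a j‖ * ‖u j‖ * (Real.exp ((n - j) * c) *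
        ∫ t : ℝ, ‖(c:ℂ) + t * Complex.I‖ ^ (-(b+1))) := by
      intro j
      rw [← integral_const_mul, ← integral_const_mul]
      congr 1; funext t
      simp only [hF]
      rw [norm_mul, hnorm, norm_mul]
    simp_rw [this]
    refine Summable.of_nonneg_of_le (fun j => by positivity) (fun j => ?_)
      ((Ac_norm_summable a c hc).mul_left (M * Real.exp (n * c) * ∫ t : ℝ, ‖(c:ℂ) + t * Complex.I‖ ^ (-(b+1))))
    have h1 : Real.exp ((n - j) * c) = Real.exp (n * c) * Real.exp (-(j * c)) := by
      rw [← Real.exp_add]; congr 1; ring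
    rw [h1]
    have hI : 0 ≤ ∫ t : ℝ, ‖(c:ℂ) + t * Complex.I‖ ^ (-(b+1)) := by positivity
    have := hu j
    calc _ ≤ ‖Ac a j‖ * M * (Real.exp (n * c) * Real.exp (-(j * c)) * ∫ t : ℝ, ‖(c:ℂ) + t * Complex.I‖ ^ (-(b+1))) := by
          gcongr
      _ = _ := by ring
  have hs := hasSum_integral_of_summable_integral_norm hitg hsum
  have hpt : ∀ t : ℝ, ∑' j, F j t = (∑' j : ℕ, Ac a j * u j * Complex.exp (-(j * ((c:ℂ) + t * Complex.I))))
      * (Complex.exp (n * (c + t * Complex.I)) * ((c:ℂ) + t * Complex.I) ^ (-((b + 1 : ℝ):ℂ))) := by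
    intro t
    rw [← tsum_mul_right]
    refine tsum_congr fun j => ?_
    simp only [hF]
    have : Complex.exp (((n - j : ℝ) : ℝ) * (c + t * Complex.I)) =
      Complex.exp (-(j * ((c:ℂ) + t * Complex.I))) * Complex.exp (n * (c + t * Complex.I)) := by
      rw [← Complex.exp_add]; congr 1; push_cast; ring
    rw [this]; ring
  simp_rw [hpt] at hs
  rw [← hs.tsum_eq, tsum_eq_sum (s := Finset.range n), Finset.sum_mul]
  · refine Finset.sum_congr rfl fun j hj => ?_
    have hj : j < n := Finset.mem_range.1 hj
    simp only [hF]
    have hjn : (j:ℝ) < n := by exact_mod_cast hj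
    rw [integral_const_mul, perron c hc b hb, if_pos (by linarith), Nat.cast_sub hj.le]
    ring
  · intro j hj
    have hj : n ≤ j := by simpa using hj
    simp only [hF]
    have hjn : (n:ℝ) ≤ j := by exact_mod_cast hj
    rw [integral_const_mul, perron c hc b hb, if_neg (by linarith)]
    ring

lemma twist_sum (a : ℕ) (haodd : Odd a) (ha : 3 ≤ a) (q : ℕ) [NeZero q] (n : ℕ) (z : ℂ) (hz : 0 < z.re) :
    ∑' j : ℕ, Ac a j * (∑ h : (ZMod q)ˣ, ZMod.stdAddChar (N := q) ((h:ZMod q) * n - h * j)) * Complex.exp (-(j * z))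
    = (2*Real.pi/(Complex.I*q*z))^(a+1) * ∑' m:ℕ, Ac a m * KN n m q * Complex.exp (-(4*Real.pi^2*m/(q^2*z))) := by
  have hq : (q:ℂ) ≠ 0 := by exact_mod_cast NeZero.ne q
  have hz0 : z ≠ 0 := by rintro rfl; simp at hz
  have hpi := Real.pi_pos
  set w : ℂ := 4 * Real.pi^2/(q^2*z) with hw
  have hwm : ∀ m : ℕ, (4*Real.pi^2*m/(q^2*z) : ℂ) = m * w := fun m => by rw [hw]; ring
  have hwre : 0 < w.re := by
    have : w = ((4 * Real.pi^2 / q^2 : ℝ) : ℂ) * z⁻¹ := by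
      rw [hw]; push_cast; field_simp
    have hq' : (0:ℝ) < q := by exact_mod_cast Nat.pos_of_ne_zero (NeZero.ne q)
    have hns : 0 < Complex.normSq z := Complex.normSq_pos.2 hz0
    rw [this, Complex.re_ofReal_mul, Complex.inv_re]
    positivity
  have hone : ∀ x : ZMod q, ‖ZMod.stdAddChar (N := q) x‖ ≤ 1 := fun x => (psi_norm _ x).le
  have key : ∀ h : (ZMod q)ˣ,
      ∑' j : ℕ, Ac a j * ZMod.stdAddChar (N := q) ((h:ZMod q) * n - h * j) * Complex.exp (-(j * z))
      = (2*Real.pi/(Complex.I*q*z))^(a+1) * ∑' m:ℕ, Ac a m *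
          ZMod.stdAddChar (N := q) ((n:ZMod q) * h + m * ((h⁻¹ : (ZMod q)ˣ) : ZMod q)) * Complex.exp (-(m * w)) := by
    intro h
    have := modular_twist a haodd ha q h z hz
    simp_rw [hwm] at this
    have h2 := congrArg (fun x => ZMod.stdAddChar (N := q) ((n:ZMod q) * h) * x) this
    rw [mul_left_comm, ← tsum_mul_left, ← tsum_mul_left] at h2
    refine Eq.trans ?_ (h2.trans ?_)
    · refine tsum_congr fun j => ?_
      rw [show (h:ZMod q) * n - h * j = n * h + -h * j by ring, AddChar.map_add_eq_mul]
      ring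
    · congr 1
      refine tsum_congr fun j => ?_
      rw [AddChar.map_add_eq_mul, mul_comm ((h⁻¹ : (ZMod q)ˣ) : ZMod q)]
      ring
  simp_rw [hwm, KN_eq, KS, Finset.mul_sum, Finset.sum_mul]
  rw [Summable.tsum_finsetSum (fun h _ => Ac_summable_w a _ 1 (fun j => hone _) z hz),
    Summable.tsum_finsetSum (fun h _ => Ac_summable_w a _ 1 (fun j => hone _) w hwre), Finset.mul_sum]
  exact Finset.sum_congr rfl fun h _ => key h

open MeasureTheory

/-- The kernel of the dual side. -/
noncomputable def Wt (a n q m : ℕ) (b c t : ℝ) : ℂ :=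
  (2*Real.pi/(Complex.I*q*((c:ℂ) + t * Complex.I)))^(a+1) *
    Complex.exp (-(4*Real.pi^2*m/(q^2*((c:ℂ) + t * Complex.I)))) *
    (Complex.exp (n * (c + t * Complex.I)) * ((c:ℂ) + t * Complex.I) ^ (-((b + 1 : ℝ):ℂ)))

lemma Wt_norm (a n q m : ℕ) (hq : 0 < q) (b c t : ℝ) (hc : 0 < c) :
    ‖Wt a n q m b c t‖ = (2 * Real.pi) ^ (a+1) * (q:ℝ) ^ (-(a + 1 : ℝ)) * Real.exp (n * c) *
      ‖(c:ℂ) + t * Complex.I‖ ^ (-(a + b + 2)) *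
      Real.exp (-(4 * Real.pi^2 * m / q^2 * c * ‖(c:ℂ) + t * Complex.I‖ ^ (-2:ℝ))) := by
  have hpi := Real.pi_pos
  have hz0 := line_ne c hc t
  have hz : 0 < ‖(c:ℂ) + t * Complex.I‖ := norm_pos_iff.2 hz0
  have hq' : (0:ℝ) < q := by exact_mod_cast hq
  have hre : ((c:ℂ) + t * Complex.I).re = c := by simp
  rw [Wt, norm_mul, norm_mul, norm_mul, norm_line_cpow c hc, Complex.norm_exp, Complex.norm_exp, norm_pow,
    norm_div, norm_mul, norm_mul, norm_mul]
  have e1 : (-(4*Real.pi^2*m/(q^2*((c:ℂ) + t * Complex.I)))).re =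
      -(4 * Real.pi^2 * m / q^2 * c * ‖(c:ℂ) + t * Complex.I‖ ^ (-2:ℝ)) := by
    have : (4*Real.pi^2*m/(q^2*((c:ℂ) + t * Complex.I))) =
      ((4 * Real.pi^2 * m / q^2 : ℝ) : ℂ) * ((c:ℂ) + t * Complex.I)⁻¹ := by
      push_cast
      have : (q:ℂ) ≠ 0 := by exact_mod_cast hq.ne'
      field_simp
    rw [this, Complex.neg_re, Complex.re_ofReal_mul, Complex.inv_re, hre, Complex.normSq_eq_norm_sq,
      Real.rpow_neg hz.le, Real.rpow_ofNat]
    ring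
  have e2 : ((n:ℂ) * (c + t * Complex.I)).re = n * c := by simp
  rw [e1, e2, Complex.norm_I, one_mul, Complex.norm_natCast, Complex.norm_real, Complex.norm_ofNat,
    Real.norm_of_nonneg hpi.le, div_pow, mul_pow (q:ℝ)]
  rw [show (-(a + b + 2) : ℝ) = -((a + 1 : ℕ):ℝ) + (-(b+1)) by push_cast; ring, Real.rpow_add hz,
    Real.rpow_neg hz.le ((a + 1 : ℕ):ℝ), Real.rpow_natCast, show (-(a + 1 : ℝ)) = -((a + 1 : ℕ):ℝ) by push_cast; ring,
    Real.rpow_neg hq'.le, Real.rpow_natCast]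
  field_simp

lemma exp_neg_le (B : ℝ) (hB : 0 < B) (y : ℝ) (hy : 0 < y) : Real.exp (-y) ≤ B ^ B * y ^ (-B) := by
  have h1 : y / B ≤ Real.exp (y / B) := by linarith [Real.add_one_le_exp (y / B)]
  have h2 : (y / B) ^ B ≤ Real.exp y := by
    calc (y / B) ^ B ≤ (Real.exp (y / B)) ^ B := Real.rpow_le_rpow (by positivity) h1 hB.le
      _ = Real.exp y := by rw [← Real.exp_mul]; congr 1; field_simp
  rw [Real.div_rpow hy.le hB.le, div_le_iff₀ (by positivity)] at h2
  rw [Real.exp_neg, Real.rpow_neg hy.le, inv_le_iff_one_le_mul₀ (Real.exp_pos _)]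
  have : 0 < y ^ B := by positivity
  rw [mul_right_comm, ← div_eq_mul_inv, le_div_iff₀ this]
  linarith

lemma Wt_norm_le (a n q m : ℕ) (hn : 0 < n) (hq : 0 < q) (hm : 0 < m) (b B β : ℝ) (hB : 0 < B)
    (hβ : 2 * B + β = a + b + 2) (t : ℝ) :
    ‖Wt a n q m b (1/n) t‖ ≤ ((2 * Real.pi) ^ (a+1) * Real.exp 1 * B ^ B * (4 * Real.pi^2) ^ (-B)) *
      ((m:ℝ) ^ (-B) * (q:ℝ) ^ (2 * B - (a+1)) * (n:ℝ)^B) * ‖((1/n : ℝ):ℂ) + t * Complex.I‖ ^ (-β) := by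
  have hpi := Real.pi_pos
  have hn' : (0:ℝ) < n := by exact_mod_cast hn
  have hm' : (0:ℝ) < m := by exact_mod_cast hm
  have hq' : (0:ℝ) < q := by exact_mod_cast hq
  have hc : (0:ℝ) < 1 / n := by positivity
  have hz : 0 < ‖((1/n:ℝ):ℂ) + t * Complex.I‖ := norm_pos_iff.2 (line_ne _ hc t)
  rw [Wt_norm a n q m hq b _ t hc]
  set Z := ‖((1/n:ℝ):ℂ) + t * Complex.I‖
  have h1 := exp_neg_le B hB (4 * Real.pi^2 * m / q^2 * (1/n) * Z ^ (-2:ℝ)) (by positivity)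
  have h2 : (4 * Real.pi^2 * m / q^2 * (1/n) * Z ^ (-2:ℝ)) ^ (-B)
      = (4 * Real.pi^2) ^ (-B) * (m:ℝ) ^ (-B) * (q:ℝ) ^ (2 * B) * (n:ℝ)^B * Z ^ (2 * B) := by
    rw [Real.mul_rpow (by positivity) (by positivity), Real.mul_rpow (by positivity) (by positivity),
      Real.div_rpow (by positivity) (by positivity), Real.mul_rpow (by positivity) (by positivity),
      ← Real.rpow_mul hz.le, one_div, Real.inv_rpow hn'.le, Real.rpow_neg hn'.le, inv_inv,
      ← Real.rpow_natCast (q:ℝ) 2, ← Real.rpow_mul hq'.le, div_eq_mul_inv, ← Real.rpow_neg hq'.le]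
    congr 2
    · congr 2; push_cast; ring_nf
    · ring
  rw [h2] at h1
  have e1 : (n:ℝ) * (1/n) = 1 := by field_simp
  rw [e1]
  calc _ ≤ (2 * Real.pi) ^ (a + 1) * (q:ℝ) ^ (-(a + 1:ℝ)) * Real.exp 1 * Z ^ (-(a + b + 2)) *
        (B ^ B * ((4 * Real.pi^2) ^ (-B) * (m:ℝ) ^ (-B) * (q:ℝ) ^ (2 * B) * (n:ℝ)^B * Z ^ (2 * B))) := by
        gcongr
    _ = _ := by
      rw [show -β = -(a+b+2) + 2 * B by linarith, Real.rpow_add hz,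
        show 2 * B - (a+1) = -(a+1:ℝ) + 2 * B by ring, Real.rpow_add hq']
      ring

lemma Wt_cont (a n q m : ℕ) (hq : 0 < q) (b c : ℝ) (hc : 0 < c) : Continuous (Wt a n q m b c) := by
  have hq' : (q:ℂ) ≠ 0 := by exact_mod_cast hq.ne'
  unfold Wt
  have h0 := line_ne c hc
  apply Continuous.mul
  · apply Continuous.mul
    · apply Continuous.pow
      exact continuous_const.div (by fun_prop) fun t => mul_ne_zero (mul_ne_zero Complex.I_ne_zero hq') (h0 t)
    · apply Complex.continuous_exp.comp
      apply Continuous.neg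
      exact continuous_const.div (by fun_prop) fun t => mul_ne_zero (pow_ne_zero _ hq') (h0 t)
  · exact Continuous.mul (by fun_prop) (line_cpow_cont c hc _)

lemma Wt_integrable (a n q m : ℕ) (hq : 0 < q) (b c : ℝ) (hc : 0 < c) (hb : 0 < b) :
    Integrable (Wt a n q m b c) := by
  have h2 : (1:ℝ) < a + b + 2 := by
    have : (0:ℝ) ≤ a := by positivity
    linarith
  refine Integrable.mono' ((line_integrable c hc (a + b + 2) h2).const_mul
    ((2 * Real.pi) ^ (a+1) * (q:ℝ) ^ (-(a + 1 : ℝ)) * Real.exp (n * c)))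
    (Wt_cont a n q m hq b c hc).aestronglyMeasurable ?_
  refine Filter.Eventually.of_forall fun t => ?_
  rw [Wt_norm a n q m hq b c t hc]
  apply mul_le_of_le_one_right
  · have := Real.pi_pos; positivity
  · rw [Real.exp_le_one_iff, neg_nonpos]; positivity

/-- The constant in the bound for the dual integrals. -/
noncomputable def Dc (a : ℕ) (B β : ℝ) : ℝ :=
  ((2 * Real.pi) ^ (a+1) * Real.exp 1 * B ^ B * (4 * Real.pi^2) ^ (-B)) * ∫ u : ℝ, (1 + ‖u‖ ^ 2) ^ (-β/2)

lemma Dc_nonneg (a : ℕ) (B β : ℝ) (hB : 0 < B) : 0 ≤ Dc a B β := by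
  have := Real.pi_pos
  unfold Dc
  have : 0 ≤ ∫ u : ℝ, (1 + ‖u‖ ^ 2) ^ (-β/2) := integral_nonneg fun u => by positivity
  positivity

lemma Wt_int_le (a n q m : ℕ) (hn : 0 < n) (hq : 0 < q) (hm : 0 < m) (b B β : ℝ) (hB : 0 < B) (hb : 0 < b)
    (hβ1 : 1 < β) (hβ : 2 * B + β = a + b + 2) :
    ∫ t, ‖Wt a n q m b (1/n) t‖ ≤ Dc a B β *
      ((m:ℝ) ^ (-B) * (q:ℝ) ^ (2 * B - (a+1)) * (n:ℝ)^(B + β - 1)) := by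
  have hn' : (0:ℝ) < n := by exact_mod_cast hn
  have hc : (0:ℝ) < 1 / n := by positivity
  have h := integral_mono (Wt_integrable a n q m hq b (1/n) hc hb).norm
    ((line_integrable (1/n) hc β hβ1).const_mul _)
    (fun t => Wt_norm_le a n q m hn hq hm b B β hB hβ t)
  refine h.trans (le_of_eq ?_)
  rw [integral_const_mul, line_integral _ hc, Dc, show B + β - 1 = B + (β - 1) by ring, Real.rpow_add hn',
    one_div, Real.inv_rpow hn'.le, ← Real.rpow_neg hn'.le, neg_sub]
  ring

/-- Main term integral. -/
lemma Wt_zero (a n q : ℕ) (hn : 0 < n) (hq : 0 < q) (b c : ℝ) (hc : 0 < c) (hb : 0 < b) :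
    ∫ t, Wt a n q 0 b c t = (-2 * Real.pi * Complex.I) ^ (a+1) * (((q:ℝ) ^ (-(a+1:ℝ)) : ℝ) : ℂ)
      * (2 * Real.pi / Real.Gamma (a + b + 2)) * (((n:ℝ) ^ (a + b + 1) : ℝ) : ℂ) := by
  have hq' : (q:ℂ) ≠ 0 := by exact_mod_cast hq.ne'
  have hqr : (0:ℝ) < q := by exact_mod_cast hq
  have hn' : (0:ℝ) < n := by exact_mod_cast hn
  have h := perron c hc (a + b + 1) (by positivity) n
  rw [if_pos hn'] at h
  rw [mul_assoc _ (_ / _), show (a:ℝ) + b + 2 = a + b + 1 + 1 by ring, ← h, ← integral_const_mul]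
  congr 1; funext t
  have h0 := line_ne c hc t
  rw [Wt]
  have e1 : ((c:ℂ) + t * Complex.I) ^ (-((a + b + 1 + 1 : ℝ):ℂ)) =
      (((c:ℂ) + t * Complex.I) ^ (a+1))⁻¹ * ((c:ℂ) + t * Complex.I) ^ (-((b + 1 : ℝ):ℂ)) := by
    rw [← Complex.cpow_natCast, ← Complex.cpow_neg, ← Complex.cpow_add _ _ h0]
    congr 1; push_cast; ring
  have e2 : (((q:ℝ) ^ (-(a+1:ℝ)) : ℝ) : ℂ) = ((q:ℂ) ^ (a+1))⁻¹ := by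
    rw [show (-(a + 1 : ℝ)) = -((a + 1 : ℕ):ℝ) by push_cast; ring, Real.rpow_neg hqr.le, Real.rpow_natCast]
    push_cast; rfl
  have e3 : (2*Real.pi/(Complex.I*q*((c:ℂ) + t * Complex.I))) =
      (-2 * Real.pi * Complex.I) * (q:ℂ)⁻¹ * ((c:ℂ) + t * Complex.I)⁻¹ := by
    rw [div_eq_mul_inv, mul_inv, mul_inv, Complex.inv_I]; ring
  rw [e1, e2, e3, mul_pow, mul_pow, inv_pow, inv_pow]
  simp only [Nat.cast_zero, mul_zero, zero_div, neg_zero, Complex.exp_zero, Complex.ofReal_natCast]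
  ring

open MeasureTheory

lemma Sig_summable (a : ℕ) (ha : 3 ≤ a) (B : ℝ) (hB : a + 1 < B) :
    Summable (fun m : ℕ => ‖Ac a (m+1)‖ * ((m+1 : ℕ):ℝ) ^ (-B)) := by
  obtain ⟨K, hK, h⟩ := Ac_bound a ha
  have hs : Summable (fun m : ℕ => (m:ℝ) ^ ((a:ℝ) - B)) := Real.summable_nat_rpow.2 (by linarith)
  refine Summable.of_nonneg_of_le (fun m => by positivity) (fun m => ?_)
    (((summable_nat_add_iff 1).2 hs).mul_left K)
  have hm : (0:ℝ) < ((m+1 : ℕ):ℝ) := by positivity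
  have := h (m+1) (by omega)
  calc _ ≤ (K * ((m+1 : ℕ):ℝ) ^ a) * ((m+1 : ℕ):ℝ) ^ (-B) := by gcongr
    _ = _ := by
      rw [sub_eq_add_neg, Real.rpow_add hm, Real.rpow_natCast]; ring

/-- The arithmetic part attached to the modulus `q`. -/
noncomputable def Pq (a n q : ℕ) (b : ℝ) : ℂ :=
  ∑ j ∈ Finset.range n, Ac a j * KN (n - j) 0 q * (((((n - j : ℕ) : ℝ)) ^ b : ℝ) : ℂ)

lemma Pq_integral (a : ℕ) (haodd : Odd a) (ha : 3 ≤ a) (n q : ℕ) (hn : 0 < n) (hq : 0 < q) (b : ℝ) (hb : 0 < b) :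
    Pq a n q b * (2 * Real.pi / Real.Gamma (b + 1)) =
    ∫ t : ℝ, ∑' m : ℕ, Ac a m * KN n m q * Wt a n q m b (1/n) t := by
  haveI : NeZero q := ⟨hq.ne'⟩
  have hn' : (0:ℝ) < n := by exact_mod_cast hn
  have hc : (0:ℝ) < 1 / n := by positivity
  have h := step1 a n hn b hb
    (fun j => ∑ h : (ZMod q)ˣ, ZMod.stdAddChar (N := q) ((h:ZMod q) * n - h * j))
    (Fintype.card (ZMod q)ˣ) (fun j => by
      refine (norm_sum_le _ _).trans ?_
      rw [Finset.sum_congr rfl (fun h _ => psi_norm _ _)]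
      simp) (1/n) hc
  have e : Pq a n q b = ∑ j ∈ Finset.range n, Ac a j *
      (∑ h : (ZMod q)ˣ, ZMod.stdAddChar (N := q) ((h:ZMod q) * n - h * j)) * (((((n - j : ℕ) : ℝ)) ^ b : ℝ) : ℂ) := by
    refine Finset.sum_congr rfl fun j hj => ?_
    congr 2
    rw [KN_eq, KS]
    refine Finset.sum_congr rfl fun h _ => ?_
    have hj : j < n := Finset.mem_range.1 hj
    rw [Nat.cast_sub hj.le]
    congr 1
    push_cast
    ring
  rw [e, h]
  congr 1; funext t
  rw [twist_sum a haodd ha q n _ (by simpa using hn), mul_assoc, mul_left_comm, mul_comm, ← tsum_mul_left]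
  refine tsum_congr fun m => ?_
  rw [Wt]; ring

lemma Pq_hasSum (a : ℕ) (haodd : Odd a) (ha : 3 ≤ a) (n q : ℕ) (hn : 0 < n) (hq : 0 < q) (b : ℝ) (hb : 0 < b)
    (B β : ℝ) (hB : a + 1 < B) (hβ1 : 1 < β) (hβ : 2 * B + β = a + b + 2) :
    HasSum (fun m : ℕ => Ac a m * KN n m q * ∫ t, Wt a n q m b (1/n) t)
      (Pq a n q b * (2 * Real.pi / Real.Gamma (b + 1))) := by
  have hn' : (0:ℝ) < n := by exact_mod_cast hn
  have hc : (0:ℝ) < 1 / n := by positivity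
  have hB0 : 0 < B := by
    have : (0:ℝ) ≤ a := by positivity
    linarith
  rw [Pq_integral a haodd ha n q hn hq b hb]
  have hs := hasSum_integral_of_summable_integral_norm (μ := volume)
    (F := fun m t => Ac a m * KN n m q * Wt a n q m b (1/n) t)
    (fun m => (Wt_integrable a n q m hq b (1/n) hc hb).const_mul _) ?_
  · simp_rw [integral_const_mul] at hs
    exact hs
  · have e : ∀ m, ∫ t, ‖Ac a m * KN n m q * Wt a n q m b (1/n) t‖
        = ‖Ac a m‖ * ‖KN n m q‖ * ∫ t, ‖Wt a n q m b (1/n) t‖ := by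
      intro m
      simp_rw [norm_mul]
      rw [integral_const_mul]
    simp_rw [e]
    rw [← summable_nat_add_iff 1]
    refine Summable.of_nonneg_of_le (fun m => by positivity) (fun m => ?_)
      ((Sig_summable a ha B hB).mul_left (q * Dc a B β * ((q:ℝ) ^ (2 * B - (a+1)) * (n:ℝ)^(B + β - 1))))
    have h1 := Wt_int_le a n q (m+1) hn hq (by omega) b B β hB0 hb hβ1 hβ
    have h2 := KN_bound_triv n (m+1) q
    calc _ ≤ ‖Ac a (m+1)‖ * q * (Dc a B β *
      (((m+1 : ℕ):ℝ) ^ (-B) * (q:ℝ) ^ (2 * B - (a+1)) * (n:ℝ)^(B + β - 1))) := by gcongr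
      _ = _ := by ring

lemma Pq_split (a : ℕ) (haodd : Odd a) (ha : 3 ≤ a) (n q : ℕ) (hn : 0 < n) (hq : 0 < q) (b : ℝ) (hb : 0 < b)
    (B β : ℝ) (hB : a + 1 < B) (hβ1 : 1 < β) (hβ : 2 * B + β = a + b + 2) :
    ‖Pq a n q b * (2 * Real.pi / Real.Gamma (b + 1)) - Ac a 0 * KN n 0 q * ∫ t, Wt a n q 0 b (1/n) t‖
      ≤ (∑' m : ℕ, ‖Ac a (m+1)‖ * ((m+1 : ℕ):ℝ) ^ (-B)) * Dc a B β *
        (wK n q * (q:ℝ) ^ (2 * B - (a+1)) * (n:ℝ)^(B + β - 1)) := by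
  have hB0 : 0 < B := by
    have : (0:ℝ) ≤ a := by positivity
    linarith
  have hs := Pq_hasSum a haodd ha n q hn hq b hb B β hB hβ1 hβ
  rw [← hs.tsum_eq, hs.summable.tsum_eq_zero_add, add_sub_cancel_left, mul_assoc, ← tsum_mul_right]
  refine tsum_of_norm_bounded ((Sig_summable a ha B hB).mul_right _).hasSum fun m => ?_
  have h1 := Wt_int_le a n q (m+1) hn hq (by omega) b B β hB0 hb hβ1 hβ
  have h2 := KN_bound n (m+1) q
  rw [norm_mul, norm_mul]
  have h3 := norm_integral_le_integral_norm (μ := volume) (Wt a n q (m+1) b (1/n))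
  have h4 := wK_nonneg n q
  calc _ ≤ ‖Ac a (m+1)‖ * wK n q * (Dc a B β *
      (((m+1 : ℕ):ℝ) ^ (-B) * (q:ℝ) ^ (2 * B - (a+1)) * (n:ℝ)^(B + β - 1))) := by
        gcongr
        exact h3.trans h1
    _ = _ := by ring

lemma zeta_real (x : ℝ) (hx : 1 < x) : riemannZeta (x:ℂ) = (zetaR x : ℂ) := by
  have h : riemannZeta (x:ℂ) = ((∑' n : ℕ, 1 / (n:ℝ) ^ x : ℝ) : ℂ) := by
    rw [zeta_eq_tsum_one_div_nat_cpow (by simpa using hx), Complex.ofReal_tsum]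
    refine tsum_congr fun n => ?_
    push_cast
    rw [Complex.ofReal_cpow (by positivity)]
    simp
  rw [zetaR, h, Complex.ofReal_re]

lemma T_eq (a : ℕ) (n : ℕ) (hn : 0 < n) (b : ℝ) (hb : 1 < b) :
    ∑ j ∈ Finset.range n, Ac a j * ((sigmaR b (n - j) : ℝ) : ℂ)
      = riemannZeta (b + 1 : ℂ) * ∑' q : ℕ, Pq a n q b * (((q:ℝ) ^ (-b-1) : ℝ) : ℂ) := by
  have hsum : ∀ j ∈ Finset.range n, Summable (fun q : ℕ => Ac a j * (((((n - j : ℕ) : ℝ)) ^ b : ℝ) : ℂ) *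
      (KN (n-j) 0 q * (((q:ℝ) ^ (-b-1) : ℝ) : ℂ))) := fun j _ => (ram_summable (n-j) b hb).mul_left _
  have e : ∀ q : ℕ, Pq a n q b * (((q:ℝ) ^ (-b-1) : ℝ) : ℂ) = ∑ j ∈ Finset.range n,
      Ac a j * (((((n - j : ℕ) : ℝ)) ^ b : ℝ) : ℂ) * (KN (n-j) 0 q * (((q:ℝ) ^ (-b-1) : ℝ) : ℂ)) := by
    intro q
    rw [Pq, Finset.sum_mul]
    exact Finset.sum_congr rfl fun j _ => by ring
  simp_rw [e]
  rw [Summable.tsum_finsetSum hsum, Finset.mul_sum]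
  refine Finset.sum_congr rfl fun j hj => ?_
  have hj : j < n := Finset.mem_range.1 hj
  rw [tsum_mul_left, ramanujan (n-j) (by omega) b hb]
  ring

open MeasureTheory

/-- The complex main term. -/
lemma main_eq (a : ℕ) (haodd : Odd a) (ha : 3 ≤ a) (n : ℕ) (hn : 0 < n) (b : ℝ) (hb : 1 < b) :
    riemannZeta (b + 1 : ℂ) * (Real.Gamma (b + 1) / (2 * Real.pi)) *
      ∑' q : ℕ, (Ac a 0 * KN n 0 q * ∫ t, Wt a n q 0 b (1/n) t) * (((q:ℝ) ^ (-b-1) : ℝ) : ℂ)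
    = (((Real.Gamma ((a : ℝ) + 1) * Real.Gamma (b + 1) / Real.Gamma ((a : ℝ) + b + 2))
            * (zetaR ((a : ℝ) + 1) * zetaR (b + 1) / zetaR ((a : ℝ) + b + 2))
            * sigmaR ((a : ℝ) + b + 1) n : ℝ) : ℂ) := by
  have hpi : (Real.pi : ℂ) ≠ 0 := by exact_mod_cast Real.pi_pos.ne'
  have ha0 : (0:ℝ) ≤ a := by positivity
  have hn' : (0:ℝ) < n := by exact_mod_cast hn
  have hG : (Real.Gamma ((a : ℝ) + b + 2) : ℂ) ≠ 0 := by
    exact_mod_cast (Real.Gamma_pos_of_pos (by linarith : (0:ℝ) < a + b + 2)).ne'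
  have hr := ramanujan n hn (a + b + 1) (by linarith)
  have hz1 := zeta_real (a + b + 2) (by linarith)
  have hzne : riemannZeta ((a + b + 2 : ℝ) : ℂ) ≠ 0 :=
    riemannZeta_ne_zero_of_one_lt_re (by rw [Complex.ofReal_re]; linarith)
  have hz2 := zeta_real (b + 1) (by linarith)
  have hz3 := zeta_real (a + 1) (by have : (3:ℝ) ≤ a := by exact_mod_cast ha
                                    linarith)
  have hzn := zeta_neg_formula a haodd ha
  have e : ∀ q : ℕ, (Ac a 0 * KN n 0 q * ∫ t, Wt a n q 0 b (1/n) t) * (((q:ℝ) ^ (-b-1) : ℝ) : ℂ)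
      = (Ac a 0 * (-2 * Real.pi * Complex.I) ^ (a+1) * (2 * Real.pi / Real.Gamma (a + b + 2))
        * (((n:ℝ) ^ (a + b + 1) : ℝ) : ℂ)) * (KN n 0 q * (((q:ℝ) ^ (-((a:ℝ) + b + 1)-1) : ℝ) : ℂ)) := by
    intro q
    rcases Nat.eq_zero_or_pos q with rfl | hq
    · simp [KN_zero]
    · have hq' : (0:ℝ) < q := by exact_mod_cast hq
      rw [Wt_zero a n q hn hq b _ (by positivity) (by linarith),
        show -((a:ℝ) + b + 1)-1 = -(a+1:ℝ) + (-b-1) by ring, Real.rpow_add hq']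
      push_cast
      ring
  simp_rw [e]
  rw [tsum_mul_left]
  have hg : Real.Gamma ((a:ℝ) + 1) = a.factorial := Real.Gamma_nat_eq_factorial a
  have c1 : ((a:ℂ) + b + 1 + 1) = ((a + b + 2 : ℝ) : ℂ) := by push_cast; ring
  have c2 : ((b:ℂ) + 1) = ((b + 1 : ℝ) : ℂ) := by push_cast; ring
  have c3 : (((a + 1 : ℕ)):ℂ) = ((a + 1 : ℝ) : ℂ) := by push_cast; ring
  have hr' : ((sigmaR (a + b + 1) n:ℝ):ℂ) = riemannZeta ((a + b + 2 : ℝ) : ℂ) * (((n:ℝ)^((a:ℝ) + b + 1):ℝ):ℂ) *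
      ∑' q:ℕ, KN n 0 q * (((q:ℝ)^(-((a:ℝ) + b + 1)-1):ℝ):ℂ) := by
    rw [hr, ← c1]; push_cast; rfl
  rw [c3, hz3] at hzn
  rw [hz1] at hr' hzne
  rw [c2, hz2, hg]
  simp only [Complex.ofReal_mul, Complex.ofReal_div]
  rw [hr']
  have hA : Ac a 0 = riemannZeta (-(a:ℂ)) / 2 := by simp [Ac]
  rw [hA]
  set X := ∑' q:ℕ, KN n 0 q * (((q:ℝ)^(-((a:ℝ) + b + 1)-1):ℝ):ℂ)
  set N := (((n:ℝ)^((a:ℝ) + b + 1):ℝ):ℂ)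
  set Y := (-2 * Real.pi * Complex.I) ^ (a+1)
  field_simp
  rw [Complex.ofReal_natCast]
  linear_combination (X * N * (zetaR (b+1)) * (Real.Gamma (b+1))) * hzn

theorem stmt1 (a : ℕ) (haodd : Odd a) (ha : 3 ≤ a) (b : ℝ) (hb : (a : ℝ) + 3 / 2 < b) :
    ∀ ε > 0, ∃ C : ℝ, ∀ n : ℕ, 0 < n →
      |SR a b n
        - (Real.Gamma ((a : ℝ) + 1) * Real.Gamma (b + 1) / Real.Gamma ((a : ℝ) + b + 2))
            * (zetaR ((a : ℝ) + 1) * zetaR (b + 1) / zetaR ((a : ℝ) + b + 2))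
            * sigmaR ((a : ℝ) + b + 1) n
        + 1 / 2 * zetaR (-(a : ℝ)) * sigmaR b n|
      ≤ C * (n : ℝ) ^ (((a : ℝ) + b) / 2 + 3 / 4 + ε) := by
  intro ε hε
  have ha3 : (3:ℝ) ≤ a := by exact_mod_cast ha
  have hb1 : 1 < b := by linarith
  obtain ⟨δ, hδ, hδ1, hδ2⟩ : ∃ δ : ℝ, 0 < δ ∧ 2 * δ ≤ ε ∧ 2 * δ < b - (a + 3/2) :=
    ⟨min (ε/2) ((b - (a + 3/2))/4), by apply lt_min <;> linarith,
      by linarith [min_le_left (ε/2) ((b - (a + 3/2))/4)],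
      by linarith [min_le_right (ε/2) ((b - (a + 3/2))/4)]⟩
  obtain ⟨C0, hC0, hw⟩ := wK_sum δ hδ
  set B : ℝ := (a + b + 1)/2 - 1/4 - δ with hBdef
  set β : ℝ := 3/2 + 2 * δ with hβdef
  have hB : a + 1 < B := by rw [hBdef]; linarith
  have hβ1 : 1 < β := by rw [hβdef]; linarith
  have hβ : 2 * B + β = a + b + 2 := by rw [hBdef, hβdef]; ring
  have hD := Dc_nonneg a B β (by linarith)
  set Sg : ℝ := ∑' m : ℕ, ‖Ac a (m+1)‖ * ((m+1 : ℕ):ℝ) ^ (-B) with hSg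
  have hSg0 : 0 ≤ Sg := tsum_nonneg fun m => by positivity
  set Kc : ℝ := ‖riemannZeta (b + 1 : ℂ) * (Real.Gamma (b + 1) / (2 * Real.pi) : ℂ)‖ with hKc
  have hKc0 : 0 ≤ Kc := norm_nonneg _
  refine ⟨Kc * (Sg * Dc a B β * C0), fun n hn => ?_⟩
  have hn' : (0:ℝ) < n := by exact_mod_cast hn
  have hn1 : (1:ℝ) ≤ n := by exact_mod_cast hn
  obtain ⟨hws, hwb⟩ := hw n hn
  set Mn : ℝ := (Real.Gamma ((a : ℝ) + 1) * Real.Gamma (b + 1) / Real.Gamma ((a : ℝ) + b + 2))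
            * (zetaR ((a : ℝ) + 1) * zetaR (b + 1) / zetaR ((a : ℝ) + b + 2))
            * sigmaR ((a : ℝ) + b + 1) n with hMn
  set T : ℂ := ∑ j ∈ Finset.range n, Ac a j * ((sigmaR b (n - j) : ℝ) : ℂ) with hT
  have hpi : (Real.pi : ℂ) ≠ 0 := by exact_mod_cast Real.pi_pos.ne'
  have hG : (Real.Gamma (b + 1) : ℂ) ≠ 0 := by
    exact_mod_cast (Real.Gamma_pos_of_pos (by linarith : (0:ℝ) < b + 1)).ne'
  -- the two convergent series
  set U : ℕ → ℂ := fun q => (Pq a n q b * (2 * Real.pi / Real.Gamma (b + 1))) * (((q:ℝ) ^ (-b-1) : ℝ) : ℂ) with hU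
  set V : ℕ → ℂ := fun q => (Ac a 0 * KN n 0 q * ∫ t, Wt a n q 0 b (1/n) t) * (((q:ℝ) ^ (-b-1) : ℝ) : ℂ) with hV
  have hUV : ∀ q, ‖U q - V q‖ ≤ Sg * Dc a B β * (n:ℝ)^(B + β - 1) * (wK n q * (q:ℝ)^(-(3/2) - 2*δ)) := by
    intro q
    rcases Nat.eq_zero_or_pos q with rfl | hq
    · have : U 0 - V 0 = 0 := by simp [hU, hV, KN_zero, Pq]
      rw [this, norm_zero]
      have := wK_nonneg n 0
      positivity
    · have hq' : (0:ℝ) < q := by exact_mod_cast hq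
      have h := Pq_split a haodd ha n q hn hq b (by linarith) B β hB hβ1 hβ
      simp only [hU, hV]
      rw [← sub_mul, norm_mul, Complex.norm_real, Real.norm_of_nonneg (by positivity)]
      calc _ ≤ (Sg * Dc a B β * (wK n q * (q:ℝ) ^ (2 * B - (a+1)) * (n:ℝ)^(B + β - 1))) * (q:ℝ)^(-b-1) := by
            gcongr
        _ = _ := by
            rw [show -(3/2) - 2*δ = (2 * B - (a+1)) + (-b-1) by rw [hBdef]; ring, Real.rpow_add hq']
            ring
  have hbs := hws.mul_left (Sg * Dc a B β * (n:ℝ)^(B + β - 1))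
  have hUVs : Summable (fun q => U q - V q) := Summable.of_norm_bounded hbs hUV
  have hPs : Summable (fun q : ℕ => Pq a n q b * (((q:ℝ) ^ (-b-1) : ℝ) : ℂ)) := by
    have : (fun q : ℕ => Pq a n q b * (((q:ℝ) ^ (-b-1) : ℝ) : ℂ)) = fun q => ∑ j ∈ Finset.range n,
      Ac a j * (((((n - j : ℕ) : ℝ)) ^ b : ℝ) : ℂ) * (KN (n-j) 0 q * (((q:ℝ) ^ (-b-1) : ℝ) : ℂ)) := by
      funext q
      rw [Pq, Finset.sum_mul]
      exact Finset.sum_congr rfl fun j _ => by ring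
    rw [this]
    apply summable_sum
    intro j _
    exact (ram_summable (n-j) b hb1).mul_left _
  have hUs : Summable U := by
    refine (hPs.mul_left (2 * Real.pi / Real.Gamma (b + 1) : ℂ)).congr fun q => ?_
    simp only [hU]; ring
  have hVs : Summable V := by
    have h := hUs.sub hUVs
    have e : (fun q => U q - (U q - V q)) = V := by funext q; ring
    rwa [e] at h
  have hTU : T = riemannZeta (b + 1 : ℂ) * (Real.Gamma (b + 1) / (2 * Real.pi)) * ∑' q, U q := by
    rw [hT, T_eq a n hn b hb1, ← tsum_mul_left, ← tsum_mul_left]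
    refine tsum_congr fun q => ?_
    simp only [hU]
    field_simp
  have hdiff : T - (Mn : ℂ) = riemannZeta (b + 1 : ℂ) * (Real.Gamma (b + 1) / (2 * Real.pi)) *
      ∑' q, (U q - V q) := by
    rw [hTU, hMn, ← main_eq a haodd ha n hn b hb1, hUs.tsum_sub hVs]
    ring
  have hnorm : ‖T - (Mn:ℂ)‖ ≤ Kc * (Sg * Dc a B β * (n:ℝ)^(B + β - 1) * (C0 * (n:ℝ)^δ)) := by
    rw [hdiff, norm_mul]
    apply mul_le_mul_of_nonneg_left _ hKc0
    refine (tsum_of_norm_bounded hbs.hasSum hUV).trans ?_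
    rw [tsum_mul_left]
    gcongr
  have hTre : T.re = SR a b n + 1 / 2 * zetaR (-(a : ℝ)) * sigmaR b n := by
    rw [hT, Complex.re_sum, SR, Finset.range_eq_Ico, Finset.sum_eq_sum_Ico_succ_bot hn, add_comm]
    congr 1
    · refine Finset.sum_congr rfl fun j hj => ?_
      have hj : 1 ≤ j := (Finset.mem_Ico.1 hj).1
      rw [Ac, if_neg (by omega), Complex.re_mul_ofReal, ArithmeticFunction.sigma_apply, Complex.natCast_re]
      congr 1
      rw [sigmaR]
      push_cast
      exact Finset.sum_congr rfl fun d _ => (Real.rpow_natCast _ _).symm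
    · rw [Ac, if_pos rfl, Complex.re_mul_ofReal, zetaR, Nat.sub_zero]
      congr 1
      push_cast
      rw [Complex.div_ofNat_re]
      ring
  have hfin : SR a b n - Mn + 1 / 2 * zetaR (-(a : ℝ)) * sigmaR b n = (T - (Mn:ℂ)).re := by
    rw [Complex.sub_re, hTre, Complex.ofReal_re]; ring
  rw [hfin]
  refine (Complex.abs_re_le_norm _).trans (hnorm.trans ?_)
  have hexp : (n:ℝ)^(B + β - 1) * (n:ℝ)^δ ≤ (n:ℝ) ^ (((a : ℝ) + b) / 2 + 3 / 4 + ε) := by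
    rw [← Real.rpow_add hn']
    apply Real.rpow_le_rpow_of_exponent_le hn1
    rw [hBdef, hβdef]; linarith
  calc _ = Kc * (Sg * Dc a B β * C0) * ((n:ℝ)^(B + β - 1) * (n:ℝ)^δ) := by ring
    _ ≤ _ := by gcongr
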